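/- arXiv:2309.05547 — 4 statements merged into one kernel-verified Lean document; each statement's English description precedes it below -/
import Mathlib

section
/- The group Q_{4,2} is presented by the generators x, y and the relations: y³ = 1; x⁴ = 1 and b_{−i}⁴ = 1 for every integer i ≥ 1; and [x², yxy] = 1 and [b_{−i}², yxy] = 1 for every integer i ≥ 1; where b_{−i} denotes the word [x, (yxy)^{i}]. Precisely, the homomorphism from the free group on two generators x, y onto Q_{4,2} sending x ↦ p(X) and y ↦ p(Y) is surjective with kernel the normal closure of the corresponding set of relators. -/
/-!
Common setup: the commutator convention `[a,b] = a⁻¹b⁻¹ab` of the paper, the sequence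
`x₀ = x`, `x_{i+1} = [yxy, x_i]`, the Laurent polynomial ring `R = 𝔽₂[t,t⁻¹]`, and the
images `X`, `Y` of `σ₁σ₂σ₃` and `σ₁σ₂σ₃σ₁` in `GL(3, R)` under the mod-2 reduced Burau
representation of the 4-strand braid group.
-/

open Matrix LaurentPolynomial

noncomputable section

set_option maxRecDepth 100000

/-- The paper's commutator convention: `[a,b] = a⁻¹b⁻¹ab`. -/
def br {G : Type*} [Group G] (a b : G) : G := a⁻¹ * b⁻¹ * a * b

/-- The recursively defined elements `x₀ = x`, `x_{i+1} = [yxy, x_i]`. -/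
def xseq {G : Type*} [Group G] (x y : G) : ℕ → G
  | 0 => x
  | n + 1 => br (y * x * y) (xseq x y n)

/-- `R = 𝔽₂[t,t⁻¹]`, the ring of Laurent polynomials over the field with two elements. -/
abbrev R2 : Type := LaurentPolynomial (ZMod 2)

instance : CharP R2 2 := charP_of_injective_algebraMap (algebraMap (ZMod 2) R2).injective 2

/-- The matrix `X = t·!![0,0,1; 1,0,1; 0,1,1]`. -/
def Xmat : Matrix (Fin 3) (Fin 3) R2 := (T 1 : R2) • !![0,0,1; 1,0,1; 0,1,1]

/-- The matrix `Y = t·!![0,0,1; t,1,1; 0,1,1]`. -/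
def Ymat : Matrix (Fin 3) (Fin 3) R2 := (T 1 : R2) • !![0,0,1; T 1,1,1; 0,1,1]

/-- An explicit inverse for `Xmat`. -/
def Xmatinv : Matrix (Fin 3) (Fin 3) R2 := (T (-1) : R2) • !![1,1,0; 1,0,1; 1,0,0]

/-- An explicit inverse for `Ymat`. -/
def Ymatinv : Matrix (Fin 3) (Fin 3) R2 := (T (-2) : R2) • !![0,1,1; T 1,0,T 1; T 1,0,0]

lemma Xmat_mul_Xmatinv : Xmat * Xmatinv = 1 := by
  rw [Xmat, Xmatinv, Matrix.smul_mul, Matrix.mul_smul, smul_smul, ← T_add]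
  simp only [Matrix.mul_fin_three, mul_zero, zero_mul, mul_one, one_mul, add_zero, zero_add,
    ← T_add, CharTwo.add_self_eq_zero]
  rw [Matrix.one_fin_three]
  simp only [Matrix.smul_of, Matrix.smul_cons, smul_eq_mul, Matrix.smul_empty, ← T_add,
    mul_zero, mul_one]
  norm_num [T_zero]

lemma Xmatinv_mul_Xmat : Xmatinv * Xmat = 1 := by
  rw [Xmat, Xmatinv, Matrix.smul_mul, Matrix.mul_smul, smul_smul, ← T_add]
  simp only [Matrix.mul_fin_three, mul_zero, zero_mul, mul_one, one_mul, add_zero, zero_add,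
    ← T_add, CharTwo.add_self_eq_zero]
  rw [Matrix.one_fin_three]
  simp only [Matrix.smul_of, Matrix.smul_cons, smul_eq_mul, Matrix.smul_empty, ← T_add,
    mul_zero, mul_one]
  norm_num [T_zero]

lemma Ymat_mul_Ymatinv : Ymat * Ymatinv = 1 := by
  rw [Ymat, Ymatinv, Matrix.smul_mul, Matrix.mul_smul, smul_smul, ← T_add]
  simp only [Matrix.mul_fin_three, mul_zero, zero_mul, mul_one, one_mul, add_zero, zero_add,
    ← T_add, CharTwo.add_self_eq_zero]
  rw [Matrix.one_fin_three]
  simp only [Matrix.smul_of, Matrix.smul_cons, smul_eq_mul, Matrix.smul_empty, ← T_add,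
    mul_zero, mul_one]
  norm_num [T_zero]

lemma Ymatinv_mul_Ymat : Ymatinv * Ymat = 1 := by
  rw [Ymat, Ymatinv, Matrix.mul_smul, Matrix.smul_mul, smul_smul, ← T_add]
  simp only [Matrix.mul_fin_three, mul_zero, zero_mul, mul_one, one_mul, add_zero, zero_add,
    ← T_add, CharTwo.add_self_eq_zero]
  rw [Matrix.one_fin_three]
  simp only [Matrix.smul_of, Matrix.smul_cons, smul_eq_mul, Matrix.smul_empty, ← T_add,
    mul_zero, mul_one]
  norm_num [T_zero]

/-- `X ∈ GL(3, 𝔽₂[t,t⁻¹])`, the mod-2 reduced Burau image of `σ₁σ₂σ₃`. -/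
def X : GL (Fin 3) R2 := ⟨Xmat, Xmatinv, Xmat_mul_Xmatinv, Xmatinv_mul_Xmat⟩

/-- `Y ∈ GL(3, 𝔽₂[t,t⁻¹])`, the mod-2 reduced Burau image of `σ₁σ₂σ₃σ₁`. -/
def Y : GL (Fin 3) R2 := ⟨Ymat, Ymatinv, Ymat_mul_Ymatinv, Ymatinv_mul_Ymat⟩

/-- `PGL(3, R)`, the projective general linear group: `GL(3,R)` modulo its center
(the subgroup of scalars). -/
abbrev PGL3 : Type := GL (Fin 3) R2 ⧸ Subgroup.center (GL (Fin 3) R2)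

/-- The natural projection `p : GL(3,R) → PGL(3,R)`. -/
def pp : GL (Fin 3) R2 →* PGL3 := QuotientGroup.mk' (Subgroup.center (GL (Fin 3) R2))

/-- `Q_{4,2}`, the subgroup of `PGL(3,R)` generated by `p(X)` and `p(Y)`. -/
abbrev Q42 : Subgroup PGL3 := Subgroup.closure {pp X, pp Y}

/-- The generator `x` of the free group on `x, y`. -/
def fx : FreeGroup (Fin 2) := FreeGroup.of 0

/-- The generator `y` of the free group on `x, y`. -/
def fy : FreeGroup (Fin 2) := FreeGroup.of 1

/-- The word `b_{-i} = [x, (yxy)^{i}]`, for `i ≥ 1`. -/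
def bwn (i : ℕ) : FreeGroup (Fin 2) := br fx ((fy * fx * fy) ^ i)

/-- The relators of Lemma A.7: `y³`; `x⁴` and `b_{-i}⁴` for `i ≥ 1`; and `[x², yxy]`
and `[b_{-i}², yxy]` for `i ≥ 1`. -/
def q42RelsD : Set (FreeGroup (Fin 2)) :=
  {fy ^ 3, fx ^ 4, br (fx ^ 2) (fy * fx * fy)} ∪
    {r | ∃ i : ℕ, 1 ≤ i ∧ r = bwn i ^ 4} ∪
    {r | ∃ i : ℕ, 1 ≤ i ∧ r = br (bwn i ^ 2) (fy * fx * fy)}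

namespace QP

/-- conjugation -/
abbrev cj (p : R2) : R2 := invert p

abbrev t : R2 := T 1

lemma add_self (p : R2) : p + p = 0 := CharTwo.add_self_eq_zero p

lemma eq_of_add {p q : R2} (h : p + q = 0) : p = q := by grind

lemma T_T (a b : ℤ) : (T a : R2) * T b = T (a + b) := (T_add a b).symm

lemma cj_cj (p : R2) : cj (cj p) = p := involutive_invert p

lemma cj_T (n : ℤ) : cj (T n) = T (-n) := invert_T n

lemma cj_zero : cj 0 = 0 := map_zero _
lemma cj_one : cj 1 = 1 := map_one _
lemma cj_add (p q : R2) : cj (p + q) = cj p + cj q := map_add _ _ _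
lemma cj_mul (p q : R2) : cj (p * q) = cj p * cj q := map_mul _ _ _

lemma z2 (a : ZMod 2) (h : a ≠ 0) : a = 1 := by
  revert a; decide

def Ge (N : ℤ) (p : R2) : Prop := ∀ i < N, p.coeff i = 0

lemma Ge.zero (N : ℤ) : Ge N 0 := fun i _ => by simp

lemma Ge.add {N : ℤ} {p q : R2} (hp : Ge N p) (hq : Ge N q) : Ge N (p + q) := fun i hi => by
  simp [hp i hi, hq i hi]

lemma Ge.mono {M N : ℤ} {p : R2} (hp : Ge N p) (h : M ≤ N) : Ge M p := fun i hi =>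
  hp i (by omega)

lemma Ge_T {N k : ℤ} : Ge N (T k) ↔ N ≤ k := by
  constructor
  · intro h
    by_contra hc
    have := h k (by omega)
    simp at this
  · intro h i hi
    simp; omega

lemma Ge.of_T {N k : ℤ} (h : N ≤ k) : Ge N (T k) := Ge_T.2 h

lemma Ge_ind {M : ℤ} (S : AddSubgroup R2) (hS : ∀ i, M ≤ i → T i ∈ S) {p : R2} (hp : Ge M p) :
    p ∈ S := by
  obtain ⟨n, hn⟩ : ∃ n, n = p.coeff.support.card := ⟨_, rfl⟩
  induction n generalizing p with
  | zero =>
    have : p.coeff = 0 := by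
      rw [← Finsupp.support_eq_empty]; exact Finset.card_eq_zero.1 hn.symm
    have : p = 0 := by ext i; simp [this]
    rw [this]; exact S.zero_mem
  | succ n ih =>
    have : p.coeff.support.Nonempty := by
      rw [← Finset.card_pos]; omega
    obtain ⟨i, hi⟩ := this
    have hi' : p.coeff i ≠ 0 := Finsupp.mem_support_iff.1 hi
    have hMi : M ≤ i := by
      by_contra hc
      exact hi' (hp i (by omega))
    have h1 := z2 _ hi'
    have key : (p + T i).coeff.support = p.coeff.support.erase i := by
      ext j
      simp only [Finsupp.mem_support_iff, Finset.mem_erase, AddMonoidAlgebra.coeff_add, Finsupp.add_apply, T_apply]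
      by_cases hj : i = j
      · subst hj; simp [h1]; decide
      · simp [hj]; tauto
    have := ih (p := p + T i) (hp.add (Ge.of_T hMi)) (by rw [key, Finset.card_erase_of_mem hi]; omega)
    have h2 := S.add_mem this (hS i hMi)
    rwa [add_assoc, add_self, add_zero] at h2

lemma ex_Ge (p : R2) : ∃ N, Ge N p := by
  by_cases h : p.coeff.support.Nonempty
  · refine ⟨p.coeff.support.min' h, fun i hi => ?_⟩
    by_contra hc
    have := Finset.min'_le _ i (Finsupp.mem_support_iff.2 hc)
    omega
  · refine ⟨0, fun i _ => ?_⟩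
    by_contra hc
    exact h ⟨i, Finsupp.mem_support_iff.2 hc⟩

lemma all_ind (S : AddSubgroup R2) (hS : ∀ i, T i ∈ S) (p : R2) : p ∈ S := by
  obtain ⟨N, h⟩ := ex_Ge p
  exact Ge_ind S (fun i _ => hS i) h

def GeS (N : ℤ) : AddSubgroup R2 where
  carrier := {p | Ge N p}
  add_mem' := Ge.add
  zero_mem' := Ge.zero N
  neg_mem' := by intro p hp; rw [CharTwo.neg_eq]; exact hp

lemma Ge.mul {M N : ℤ} {p q : R2} (hp : Ge M p) (hq : Ge N q) : Ge (M + N) (p * q) := by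
  have := Ge_ind (M := M) ((GeS (M+N)).comap (AddMonoidHom.mulRight q)) (fun i hi => ?_) hp
  · exact this
  · have := Ge_ind (M := N) ((GeS (M+N)).comap (AddMonoidHom.mulLeft (T i : R2))) (fun j hj => ?_) hq
    · exact this
    · change Ge (M+N) (T i * T j)
      rw [T_T]; exact Ge.of_T (by omega)

lemma Ge.mul' {M N L : ℤ} {p q : R2} (hp : Ge M p) (hq : Ge N q) (h : L ≤ M + N) : Ge L (p * q) :=
  (hp.mul hq).mono h

lemma Ge.Tmul {N L : ℤ} {p : R2} (k : ℤ) (hp : Ge N p) (h : L ≤ k + N) : Ge L (T k * p) :=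
  (Ge.of_T le_rfl).mul' hp h

lemma Ge.of_Tmul {N L : ℤ} {p : R2} (k : ℤ) (hp : Ge N (T k * p)) (h : L + k ≤ N) : Ge L p := by
  have := hp.Tmul (L := L) (-k) (by omega)
  rwa [← mul_assoc, T_T, neg_add_cancel, T_zero, one_mul] at this

lemma Ge_one : Ge 0 (1 : R2) := by rw [← T_zero]; exact Ge.of_T le_rfl

lemma Ge_opt : Ge 0 (1 + T 1 : R2) := Ge_one.add (Ge.of_T (by omega))

lemma Ge_cj {N : ℤ} {p : R2} (h : Ge N (cj p)) : ∀ i, -N < i → p.coeff i = 0 := by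
  intro i hi
  have := h (-i) (by omega)
  simpa using this

lemma Ge_cj_iff {N : ℤ} {p : R2} : Ge N (cj p) ↔ ∀ i, -N < i → p.coeff i = 0 := by
  refine ⟨Ge_cj, fun h i hi => ?_⟩
  rw [cj, invert_apply]; exact h _ (by omega)

lemma Ge_both {M N : ℤ} {p : R2} (h : Ge M p) (h' : Ge N (cj p)) (hMN : -N < M) : p = 0 := by
  ext i
  by_cases hi : i < M
  · simp [h i hi]
  · simp [Ge_cj h' i (by omega)]

lemma Ge_succ {M : ℤ} {p : R2} (h : Ge M p) : Ge (M+1) p ∨ Ge (M+1) (p + T M) := by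
  by_cases hc : p.coeff M = 0
  · left; intro i hi
    by_cases h1 : i = M
    · rwa [h1]
    · exact h i (by omega)
  · right; intro i hi
    have := z2 _ hc
    by_cases h1 : i = M
    · subst h1; simp [this]; decide
    · have h2 := h i (by omega)
      simp [h2]; omega

/-- order of nonzero element -/
lemma ex_ord {p : R2} (hp : p ≠ 0) : ∃ M, Ge M p ∧ Ge (M+1) (p + T M) := by
  by_contra! hc
  obtain ⟨N, hN⟩ := ex_Ge p
  have : ∀ n : ℕ, Ge (N + n) p := by
    intro n
    induction n with
    | zero => simpa using hN
    | succ n ih =>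
      rcases Ge_succ ih with h | h
      · refine h.mono (by push_cast; omega)
      · exact absurd h (hc _ ih)
  apply hp
  ext i
  simpa using this (i - N + 1).toNat i (by omega)

lemma ord_mul {M N : ℤ} {p q : R2} (hp : Ge (M+1) (p + T M)) (hq : Ge (N+1) (q + T N)) :
    Ge (M + N + 1) (p * q + T (M+N)) := by
  have e : p * q + T (M+N) = (p + T M) * (q + T N) + (T M * (q + T N) + T N * (p + T M)) := by
    rw [← T_T]; grind
  rw [e]
  exact (hp.mul' hq (by omega)).add ((hq.Tmul _ (by omega)).add (hp.Tmul _ (by omega)))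

lemma ord_uniq {M N : ℤ} {p : R2} (hp : Ge (M+1) (p + T M)) (hq : Ge (N+1) (p + T N)) : M = N := by
  have h1 : Ge (min M N + 1) (T M + T N : R2) := by
    have e : (T M + T N : R2) = (p + T M) + (p + T N) := by grind
    rw [e]; exact (hp.mono (by omega)).add (hq.mono (by omega))
  have := h1 (min M N) (by omega)
  simp at this
  by_contra hne
  rcases lt_or_gt_of_ne hne with h | h
  · simp [h.le, not_le.2 h] at this
  · simp [h.le, not_le.2 h] at this

lemma ord_ne {M : ℤ} {p : R2} (hp : Ge (M+1) (p + T M)) : p ≠ 0 := by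
  rintro rfl
  rw [zero_add, Ge_T] at hp; omega

lemma mul_ne {p q : R2} (hp : p ≠ 0) (hq : q ≠ 0) : p * q ≠ 0 := by
  obtain ⟨M, _, h⟩ := ex_ord hp
  obtain ⟨N, _, h'⟩ := ex_ord hq
  exact ord_ne (ord_mul h h')

instance : NoZeroDivisors R2 where
  eq_zero_or_eq_zero_of_mul_eq_zero := by
    intro a b h
    by_contra! hc
    exact mul_ne hc.1 hc.2 h

lemma opt_ne : (1 + T 1 : R2) ≠ 0 := by
  refine ord_ne (M := 0) ?_
  rw [T_zero, show (1 + T 1 + 1 : R2) = T 1 by grind]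
  exact Ge.of_T (by omega)

lemma T_ne (k : ℤ) : (T k : R2) ≠ 0 := by
  refine ord_ne (M := k) ?_
  rw [add_self]; exact Ge.zero _

lemma cj_zero_iff {p : R2} : cj p = 0 ↔ p = 0 := by
  simp [cj]

lemma unit_T' {p q : R2} (h : p * q = 1) : ∃ m, p = T m := by
  have hp : p ≠ 0 := by rintro rfl; simp at h
  have hq : q ≠ 0 := by rintro rfl; simp at h
  have hp' : cj p ≠ 0 := by rwa [Ne, cj_zero_iff]
  have hq' : cj q ≠ 0 := by rwa [Ne, cj_zero_iff]
  obtain ⟨M, h1, h2⟩ := ex_ord hp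
  obtain ⟨N, h3, h4⟩ := ex_ord hq
  obtain ⟨M', h1', h2'⟩ := ex_ord hp'
  obtain ⟨N', h3', h4'⟩ := ex_ord hq'
  have a1 := ord_mul h2 h4
  have a2 := ord_mul h2' h4'
  rw [← map_mul, h, map_one] at a2
  rw [h] at a1
  have o : Ge (0 + 1) (1 + T 0 : R2) := by rw [T_zero, add_self]; exact Ge.zero _
  have b1 := ord_uniq a1 o
  have b2 := ord_uniq a2 o
  have c1 : M ≤ -M' := by
    by_contra hc
    exact hp (Ge_both h1 h1' (by omega))
  have c2 : N ≤ -N' := by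
    by_contra hc
    exact hq (Ge_both h3 h3' (by omega))
  refine ⟨M, eq_of_add (Ge_both (M := M + 1) (N := -M) h2 ?_ (by omega))⟩
  rw [cj, map_add, ← cj, ← cj, cj_T]
  exact (h1'.mono (by omega)).add (Ge.of_T (by omega))

/-- splitting -/
lemma split (N : ℤ) (p : R2) : ∃ l h, p = l + h ∧ Ge N h ∧ Ge (1 - N) (cj l) := by
  refine ⟨AddMonoidAlgebra.ofCoeff (p.coeff.filter (· < N)), AddMonoidAlgebra.ofCoeff (p.coeff.filter (fun i => ¬ i < N)), ?_, ?_, ?_⟩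
  · ext i
    simp [Finsupp.filter_apply]
    by_cases h : i < N <;> simp [h]
  · intro i hi
    simp [Finsupp.filter_apply]; omega
  · rw [Ge_cj_iff]
    intro i hi
    simp [Finsupp.filter_apply]; omega

abbrev V : Type := R2 × R2 × R2
abbrev F : Type := FreeGroup (Fin 2)

lemma tt1 : (T 1 : R2) * T (-1) = 1 := by rw [T_T]; simp [T_zero]

lemma V_ext {v w : V} (h1 : v.1 = w.1) (h2 : v.2.1 = w.2.1) (h3 : v.2.2 = w.2.2) : v = w :=
  Prod.ext h1 (Prod.ext h2 h3)

def xL : V ≃ₗ[R2] V where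
  toFun w := (w.1 + (1 + T 1) * w.2.1 + T 1 * w.2.2, w.2.1 + w.2.2, w.2.2)
  map_add' a b := by refine V_ext ?_ ?_ ?_ <;> simp <;> grind
  map_smul' a b := by refine V_ext ?_ ?_ ?_ <;> simp <;> grind
  invFun w := (w.1 + (1 + T 1) * w.2.1 + w.2.2, w.2.1 + w.2.2, w.2.2)
  left_inv w := by refine V_ext ?_ ?_ ?_ <;> simp <;> grind
  right_inv w := by refine V_ext ?_ ?_ ?_ <;> simp <;> grind

def yL : V ≃ₗ[R2] V where
  toFun w := (T 1 * w.2.2, w.2.1 + w.2.2, w.1 + (1 + T 1) * w.2.1 + w.2.2)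
  map_add' a b := by refine V_ext ?_ ?_ ?_ <;> simp <;> grind
  map_smul' a b := by refine V_ext ?_ ?_ ?_ <;> simp <;> grind
  invFun w := (w.1 + (1 + T 1) * w.2.1 + w.2.2, w.2.1 + T (-1) * w.1, T (-1) * w.1)
  left_inv w := by
    have := tt1
    refine V_ext ?_ ?_ ?_ <;> simp <;> grind
  right_inv w := by
    have := tt1
    refine V_ext ?_ ?_ ?_ <;> simp <;> grind

def lin : F →* (V ≃ₗ[R2] V) := FreeGroup.lift ![xL, yL]

lemma lin_x (w : V) : lin fx w = (w.1 + (1 + T 1) * w.2.1 + T 1 * w.2.2, w.2.1 + w.2.2, w.2.2) := by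
  rw [lin, fx, FreeGroup.lift_apply_of]; rfl

lemma lin_y (w : V) : lin fy w = (T 1 * w.2.2, w.2.1 + w.2.2, w.1 + (1 + T 1) * w.2.1 + w.2.2) := by
  rw [lin, fy, FreeGroup.lift_apply_of]; rfl

lemma lin_mul (g h : F) (w : V) : lin (g * h) w = lin g (lin h w) := by
  rw [map_mul]; rfl

lemma lin_one (w : V) : lin 1 w = w := by
  rw [map_one]; rfl

lemma lin_inv_l (g : F) (w : V) : lin g⁻¹ (lin g w) = w := by
  rw [← lin_mul, inv_mul_cancel, lin_one]

lemma lin_inv_r (g : F) (w : V) : lin g (lin g⁻¹ w) = w := by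
  rw [← lin_mul, mul_inv_cancel, lin_one]

lemma lin_smul (g : F) (c : R2) (w : V) : lin g (c • w) = c • lin g w := map_smul _ _ _

lemma lin_add (g : F) (v w : V) : lin g (v + w) = lin g v + lin g w := map_add _ _ _

/-- hermitian form -/
def hh (w w' : V) : R2 := w.1 * cj w'.2.2 + (1 + T 1) * w.2.1 * cj w'.2.1 + T 1 * w.2.2 * cj w'.1

lemma F_ind {C : F → Prop} (h1 : C 1) (hx : C fx) (hy : C fy) (hi : ∀ g, C g → C g⁻¹)
    (hm : ∀ g h, C g → C h → C (g * h)) (g : F) : C g := by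
  have hof : ∀ i : Fin 2, C (FreeGroup.of i) := by
    intro i; fin_cases i
    · exact hx
    · exact hy
  exact FreeGroup.induction_on g h1 (fun i => hof i) (fun i _ => hi _ (hof i)) (fun a b => hm a b)

lemma hh_inv (g : F) : ∀ w w' : V, hh (lin g w) (lin g w') = hh w w' := by
  have := tt1
  refine F_ind (C := fun g => ∀ w w' : V, hh (lin g w) (lin g w') = hh w w') ?_ ?_ ?_ ?_ ?_ g
  · intro w w'; rw [lin_one, lin_one]
  · intro w w'
    simp only [lin_x, hh, cj, map_add, map_mul, map_one, invert_T]
    grind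
  · intro w w'
    simp only [lin_y, hh, cj, map_add, map_mul, map_one, invert_T]
    grind
  · intro g ih w w'
    rw [← ih, lin_inv_r, lin_inv_r]
  · intro g h ig ih w w'
    rw [lin_mul, lin_mul, ig, ih]

lemma hh_smul_left (c : R2) (w w' : V) : hh (c • w) w' = c * hh w w' := by
  simp [hh]; ring

lemma hh_smul_right (c : R2) (w w' : V) : hh w (c • w') = cj c * hh w w' := by
  simp [hh]; ring

lemma hh_swap (w w' : V) : hh w' w = T 1 * cj (hh w w') := by
  have := tt1
  have := cj_cj
  simp only [cj] at this
  simp only [hh, cj, map_add, map_mul, map_one, invert_T, this]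
  grind

/-- unipotent -/
def nn (f s : R2) (w : V) : V := (w.1 + (1 + T 1) * cj f * w.2.1 + s * w.2.2, w.2.1 + f * w.2.2, w.2.2)

def DD (b : ℤ) (w : V) : V := (T b * w.1, w.2.1, T b * w.2.2)

def Val (f s : R2) : Prop := s + T 1 * cj s = (1 + T 1) * f * cj f

abbrev e1 : V := (1, 0, 0)
abbrev e2 : V := (0, 1, 0)
abbrev e3 : V := (0, 0, 1)

lemma decomp (w : V) : w = w.1 • e1 + w.2.1 • e2 + w.2.2 • e3 := by
  simp

lemma lin_decomp (g : F) (w : V) : lin g w = w.1 • lin g e1 + w.2.1 • lin g e2 + w.2.2 • lin g e3 := by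
  conv_lhs => rw [decomp w]
  simp only [lin_add, lin_smul]

lemma T_cj (k : ℤ) : (T k : R2) * T (-k) = 1 := by rw [T_T]; simp [T_zero]

/-- Elements stabilising the line of `e1`. -/
lemma stab_form (g : F) (c : R2) (hg : lin g e1 = c • e1) :
    ∃ (l b : ℤ) (f s : R2), Val f s ∧ ∀ w, lin g w = (T l : R2) • nn f s (DD b w) := by
  have i21 := hh_inv g e2 e1
  have i31 := hh_inv g e3 e1
  have i22 := hh_inv g e2 e2
  have i32 := hh_inv g e3 e2
  have i33 := hh_inv g e3 e3
  have dec := lin_decomp g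
  rw [hg] at i21 i31 dec
  obtain ⟨a, b, c', h2⟩ : ∃ a b c', lin g e2 = (a, b, c') := ⟨_, _, _, rfl⟩
  obtain ⟨s, f, d, h3⟩ : ∃ a b c', lin g e3 = (a, b, c') := ⟨_, _, _, rfl⟩
  rw [h2] at i21 i22 i32 dec
  rw [h3] at i31 i32 i33 dec
  simp only [hh, mul_zero, zero_mul, add_zero, zero_add, mul_one, one_mul, map_zero, map_one,
    Prod.smul_mk, smul_eq_mul] at i21 i31 i22 i32 i33
  have hd : d * cj c = 1 := by
    refine mul_left_cancel₀ (T_ne 1) (by rw [mul_one, ← mul_assoc]; exact i31)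
  obtain ⟨k, rfl⟩ := unit_T' hd
  have hk := T_cj k
  have hc0 : cj c = T (-k) := by grind
  have hc : c = T k := by
    rw [← cj_cj c, hc0, cj_T, neg_neg]
  have hc' : c' = 0 := by
    rw [hc0] at i21
    have h1 := mul_eq_zero.1 i21
    rcases h1 with h1 | h1
    · rcases mul_eq_zero.1 h1 with h | h
      · exact absurd h (T_ne _)
      · exact h
    · exact absurd h1 (T_ne _)
  clear i21
  subst hc'
  have hb : b * cj b = 1 := by
    simp only [map_zero, mul_zero, zero_add, zero_mul, add_zero] at i22
    exact mul_left_cancel₀ opt_ne (by rw [mul_one, ← mul_assoc]; exact i22)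
  clear i22
  obtain ⟨m, rfl⟩ := unit_T' hb
  have ha : a = (1 + T 1) * cj f * T m * T k := by
    have h5 : cj a = (1 + T 1) * f * T (-m) * T (-k) * T (-1) := by
      have := tt1
      have hm : cj (T m) = T (-m) := cj_T m
      rw [cj_zero, mul_zero, zero_add, hm] at i32
      generalize cj a = A at *
      generalize (T m : R2) = Tm at *
      grind
    have := congrArg cj h5
    rw [cj_cj] at this
    rw [this]
    have := tt1
    simp only [cj, map_mul, map_add, map_one, invert_T, neg_neg]
    grind
  refine ⟨m, k - m, f * T (-k), s * T (-k), ?_, ?_⟩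
  · simp only [Val, cj, map_mul, invert_T, neg_neg]
    rw [cj_T] at i33
    simp only [cj] at i33
    grind
  · intro w
    rw [dec, ha, hc]
    have e : (T m : R2) * T (k - m) = T k := by rw [T_T]; congr 1; ring
    clear dec i31 i32 i33 hb hd h3 h2 hg
    refine V_ext ?_ ?_ ?_ <;> simp only [nn, DD, Prod.fst_add, Prod.snd_add, Prod.smul_fst, Prod.smul_snd, smul_eq_mul, cj, map_mul, invert_T, neg_neg] <;> grind

def zz : F := fy * fx * fy
def ee : F := zz * fx
def HH : Subgroup F := Subgroup.closure {fx, zz}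
def MM : Subgroup F := Subgroup.normalClosure q42RelsD
instance : MM.Normal := Subgroup.normalClosure_normal
def PF : Subgroup F := HH ⊔ MM

lemma x_HH : fx ∈ HH := Subgroup.subset_closure (by simp)
lemma z_HH : zz ∈ HH := Subgroup.subset_closure (by simp)
lemma ee_HH : ee ∈ HH := mul_mem z_HH x_HH
lemma HH_PF : HH ≤ PF := le_sup_left
lemma MM_PF : MM ≤ PF := le_sup_right

lemma lin_ee (w : V) : lin ee w = DD 1 w := by
  simp only [ee, zz, lin_mul, lin_x, lin_y, DD]
  refine V_ext ?_ ?_ ?_ <;> simp only [] <;> grind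

lemma DD_DD (a b : ℤ) (w : V) : DD a (DD b w) = DD (a + b) w := by
  simp only [DD, ← mul_assoc, T_T]

lemma DD_zero (w : V) : DD 0 w = w := by
  simp only [DD, T_zero, one_mul]

lemma lin_ee_inv (w : V) : lin ee⁻¹ w = DD (-1) w := by
  have : w = lin ee (DD (-1) w) := by rw [lin_ee, DD_DD, add_neg_cancel, DD_zero]
  conv_lhs => rw [this]
  rw [lin_inv_l]

lemma lin_ee_zpow (j : ℤ) : ∀ w : V, lin (ee ^ j) w = DD j w := by
  induction j with
  | zero => intro w; rw [zpow_zero, lin_one, DD_zero]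
  | succ n ih => intro w; rw [_root_.zpow_add_one, lin_mul, lin_ee, ih, DD_DD]
  | pred n ih => intro w; rw [_root_.zpow_sub_one, lin_mul, lin_ee_inv, ih, DD_DD]; rfl

lemma nn_nn (f s f' s' : R2) (w : V) :
    nn f s (nn f' s' w) = nn (f + f') (s + s' + (1 + T 1) * cj f * f') w := by
  simp only [nn, cj_add]
  refine V_ext ?_ ?_ ?_ <;> simp only [] <;> ring

lemma nn_zero (w : V) : nn 0 0 w = w := by
  simp only [nn, cj_zero]
  refine V_ext ?_ ?_ ?_ <;> simp

lemma DD_nn (j : ℤ) (f s : R2) (w : V) : DD (-j) (nn f s w) = nn (T j * f) s (DD (-j) w) := by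
  simp only [nn, DD, cj_mul, cj_T]
  have := T_cj j
  refine V_ext ?_ ?_ ?_ <;> simp only [] <;> grind

lemma lin_x' (w : V) : lin fx w = nn 1 (T 1) w := by
  rw [lin_x]; simp only [nn, cj_one, mul_one, one_mul]

def Uni (f : R2) (g : F) : Prop := ∃ s, ∀ w, lin g w = nn f s w

lemma uni_inj {f s : R2} {g : F} (h : ∀ w, lin g w = nn f s w) : lin g e3 = (s, f, 1) := by
  rw [h]; simp [nn]

lemma Uni.uniq {f f' : R2} {g : F} (h : Uni f g) (h' : Uni f' g) : f = f' := by
  obtain ⟨s, h⟩ := h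
  obtain ⟨s', h'⟩ := h'
  have := (uni_inj h).symm.trans (uni_inj h')
  simp at this; tauto

lemma uni_x : Uni 1 fx := ⟨_, lin_x'⟩

lemma uni_one : Uni 0 1 := ⟨0, fun w => by rw [lin_one, nn_zero]⟩

lemma Uni.mul {f f' : R2} {g g' : F} (h : Uni f g) (h' : Uni f' g') : Uni (f + f') (g * g') := by
  obtain ⟨s, h⟩ := h
  obtain ⟨s', h'⟩ := h'
  exact ⟨_, fun w => by rw [lin_mul, h', h, nn_nn]⟩

lemma Uni.sq {f : R2} {g : F} (h : Uni f g) (w : V) :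
    lin (g ^ 2) w = nn 0 ((1 + T 1) * f * cj f) w := by
  obtain ⟨s, h⟩ := h
  rw [pow_two, lin_mul, h, h, nn_nn]
  congr 1 <;> grind

lemma Uni.inv {f : R2} {g : F} (h : Uni f g) : Uni f g⁻¹ := by
  obtain ⟨s, h⟩ := h
  refine ⟨s + (1 + T 1) * cj f * f, fun w => ?_⟩
  have : w = lin g (nn f (s + (1 + T 1) * cj f * f) w) := by
    rw [h, nn_nn]
    conv_lhs => rw [← nn_zero w]
    congr 1 <;> grind
  conv_lhs => rw [this]
  rw [lin_inv_l]

lemma Uni.ee {f : R2} {g : F} (h : Uni f g) (j : ℤ) : Uni (T j * f) (ee ^ (-j) * g * ee ^ j) := by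
  obtain ⟨s, h⟩ := h
  exact ⟨s, fun w => by rw [lin_mul, lin_mul, lin_ee_zpow, lin_ee_zpow, h, DD_nn, DD_DD,
    neg_add_cancel, DD_zero]⟩

lemma Uni.congr {f f' : R2} {g g' : F} (h : Uni f g) (e : f = f') (e' : g = g') : Uni f' g' := by
  subst e e'; exact h

lemma Uni.z {f : R2} {g : F} (h : Uni f g) : Uni (T 1 * f) (zz⁻¹ * g * zz) := by
  refine ((uni_x.mul (h.ee 1)).mul uni_x.inv).congr (by grind) ?_
  rw [QP.ee]; group

lemma Uni.z' {f : R2} {g : F} (h : Uni f g) : Uni (T (-1) * f) (zz * g * zz⁻¹) := by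
  refine (((uni_x.inv.mul h).mul uni_x).ee (-1)).congr (by grind) ?_
  rw [QP.ee]; group

lemma Uni.zpow {f : R2} {g : F} (h : Uni f g) (j : ℤ) : Uni (T j * f) (zz ^ (-j) * g * zz ^ j) := by
  induction j with
  | zero => simpa [T_zero] using h
  | succ n ih =>
    refine ih.z.congr (by rw [← mul_assoc, T_T, add_comm]) ?_
    rw [← mul_assoc, ← mul_assoc, ← _root_.zpow_neg_one, ← _root_.zpow_add, mul_assoc _ _ zz, ← _root_.zpow_add_one]
    congr 3; ring
  | pred n ih =>
    refine ih.z'.congr (by rw [← mul_assoc, T_T]; ring_nf) ?_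
    rw [← mul_assoc, ← mul_assoc, ← _root_.zpow_one_add, mul_assoc _ _ zz⁻¹, ← _root_.zpow_sub_one]
    congr 3; ring

/-- central unipotents commute with `x` and `z` -/
def Cen (s : R2) (g : F) : Prop := ∀ w, lin g w = nn 0 s w

lemma lin_eq_of {g h : F} (e : ∀ w, lin g w = lin h w) : lin g = lin h := LinearEquiv.ext e

lemma lin_br_of_comm {g h : F} (e : ∀ w, lin (g * h) w = lin (h * g) w) (w : V) :
    lin (br g h) w = w := by
  have : br g h = (h * g)⁻¹ * (g * h) := by rw [br]; group
  rw [this, lin_mul, e, lin_inv_l]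

lemma nn0_comm (s f s' : R2) (w : V) : nn 0 s (nn f s' w) = nn f s' (nn 0 s w) := by
  rw [nn_nn, nn_nn, cj_zero]; congr 1 <;> ring

lemma DD_nn0 (j : ℤ) (s : R2) (w : V) : DD j (nn 0 s w) = nn 0 s (DD j w) := by
  have := DD_nn (-j) 0 s w
  rwa [neg_neg, mul_zero] at this

lemma lin_z (w : V) : ∃ s, ∀ w, lin zz w = DD 1 (nn 1 s w) := by
  obtain ⟨s, h⟩ := uni_x.inv
  refine ⟨s, fun w => ?_⟩
  rw [← h, ← lin_ee, ← lin_mul]; congr 2; rw [ee]; group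

lemma Cen.comm_z {s : R2} {g : F} (h : Cen s g) (w : V) : lin (g * zz) w = lin (zz * g) w := by
  obtain ⟨s', h'⟩ := lin_z w
  rw [lin_mul, lin_mul, h, h', h', h, ← nn0_comm, DD_nn0]

/-- scalar elements -/
def KK : Subgroup F where
  carrier := {g | ∃ k : ℤ, ∀ w, lin g w = (T k : R2) • w}
  one_mem' := ⟨0, fun w => by rw [lin_one, T_zero, one_smul]⟩
  mul_mem' := by
    rintro g h ⟨k, hk⟩ ⟨l, hl⟩
    exact ⟨k + l, fun w => by rw [lin_mul, hl, hk, smul_smul, T_T]⟩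
  inv_mem' := by
    rintro g ⟨k, hk⟩
    refine ⟨-k, fun w => ?_⟩
    have : w = lin g ((T (-k) : R2) • w) := by
      rw [hk, smul_smul, T_T, add_neg_cancel, T_zero, one_smul]
    conv_lhs => rw [this]
    rw [lin_inv_l]

instance : KK.Normal where
  conj_mem := by
    rintro n ⟨k, hk⟩ g
    refine ⟨k, fun w => ?_⟩
    rw [lin_mul, lin_mul, hk, lin_smul, lin_inv_r]

lemma KK_of_id {g : F} (h : ∀ w, lin g w = w) : g ∈ KK := ⟨0, fun w => by rw [h, T_zero, one_smul]⟩

def xj (j : ℤ) : F := zz ^ (-j) * fx * zz ^ j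

lemma uni_xj (j : ℤ) : Uni (T j) (xj j) := (uni_x.zpow j).congr (by rw [mul_one]) rfl

lemma bwn_eq (i : ℕ) : bwn i = fx⁻¹ * xj i := by
  rw [bwn, br, xj, _root_.zpow_neg, zpow_natCast, ← zz]; group

lemma uni_bwn (i : ℕ) : Uni (1 + T i) (bwn i) := by
  rw [bwn_eq]; exact uni_x.inv.mul (uni_xj i)

lemma MM_KK : MM ≤ KK := by
  refine Subgroup.normalClosure_le_normal ?_
  have pow4 : ∀ {f : R2} {g : F}, Uni f g → g ^ 4 ∈ KK := by
    intro f g h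
    refine KK_of_id fun w => ?_
    rw [show g ^ 4 = g ^ 2 * g ^ 2 by group, lin_mul, h.sq, h.sq, nn_nn]
    conv_rhs => rw [← nn_zero w]
    congr 1 <;> simp only [cj_zero] <;> grind
  have comm : ∀ {f : R2} {g : F}, Uni f g → br (g ^ 2) zz ∈ KK := by
    intro f g h
    exact KK_of_id (lin_br_of_comm fun w => Cen.comm_z (s := (1 + T 1) * f * cj f) h.sq w)
  rintro r ((h | h) | h)
  · rcases h with rfl | rfl | rfl
    · refine ⟨1, fun w => ?_⟩
      simp only [pow_succ, pow_zero, one_mul, lin_mul, lin_y]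
      refine V_ext ?_ ?_ ?_ <;> simp only [Prod.smul_fst, Prod.smul_snd, smul_eq_mul] <;> grind
    · exact pow4 uni_x
    · exact comm uni_x
  · obtain ⟨i, _, rfl⟩ := h
    exact pow4 (uni_bwn i)
  · obtain ⟨i, _, rfl⟩ := h
    exact comm (uni_bwn i)

def StabL : Subgroup F where
  carrier := {g | ∃ k : ℤ, lin g e1 = (T k : R2) • e1}
  one_mem' := ⟨0, by rw [lin_one, T_zero, one_smul]⟩
  mul_mem' := by
    rintro g h ⟨k, hk⟩ ⟨l, hl⟩
    exact ⟨l + k, by rw [lin_mul, hl, lin_smul, hk, smul_smul, T_T]⟩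
  inv_mem' := by
    rintro g ⟨k, hk⟩
    refine ⟨-k, ?_⟩
    have : e1 = lin g ((T (-k) : R2) • e1) := by
      rw [lin_smul, hk, smul_smul, T_T, neg_add_cancel, T_zero, one_smul]
    conv_lhs => rw [this]
    rw [lin_inv_l]

lemma KK_Stab : KK ≤ StabL := by
  rintro g ⟨k, hk⟩
  exact ⟨k, hk _⟩

lemma uni_stab {f : R2} {g : F} (h : Uni f g) : g ∈ StabL := by
  obtain ⟨s, h⟩ := h
  exact ⟨0, by rw [h, T_zero]; simp [nn]⟩

lemma ee_stab : ee ∈ StabL := ⟨1, by rw [lin_ee]; simp [DD]⟩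

lemma HH_Stab : HH ≤ StabL := by
  rw [HH, Subgroup.closure_le]
  rintro g (rfl | rfl)
  · exact uni_stab uni_x
  · have : zz = ee * fx⁻¹ := by rw [ee]; group
    rw [this]
    exact mul_mem ee_stab (inv_mem (uni_stab uni_x))

lemma PF_Stab : PF ≤ StabL := sup_le HH_Stab (MM_KK.trans KK_Stab)

def Re (f s : R2) : Prop := ∃ p ∈ HH, ∀ w, lin p w = nn f s w

lemma Re.mul {f s f' s' : R2} (h : Re f s) (h' : Re f' s') :
    Re (f + f') (s + s' + (1 + T 1) * cj f * f') := by
  obtain ⟨p, hp, h⟩ := h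
  obtain ⟨p', hp', h'⟩ := h'
  exact ⟨p * p', mul_mem hp hp', fun w => by rw [lin_mul, h', h, nn_nn]⟩

lemma Re.zero : Re 0 0 := ⟨1, one_mem _, fun w => by rw [lin_one, nn_zero]⟩

lemma Re.congr {f s f' s' : R2} (h : Re f s) (e : f = f') (e' : s = s') : Re f' s' := by
  subst e e'; exact h

lemma Re.val {f s : R2} (h : Re f s) : Val f s := by
  obtain ⟨p, hp, h⟩ := h
  have := hh_inv p e3 e3
  rw [h, nn] at this
  simp only [hh, mul_zero, zero_mul, add_zero, zero_add, mul_one, one_mul, cj_zero, cj_one] at this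
  rw [Val]; grind

lemma Re.mono (i : ℤ) : Re (T i) (T 1) := by
  refine ⟨ee ^ (-i) * fx * ee ^ i, mul_mem (mul_mem (zpow_mem ee_HH _) x_HH) (zpow_mem ee_HH _), ?_⟩
  intro w
  rw [lin_mul, lin_mul, lin_ee_zpow, lin_ee_zpow, lin_x', DD_nn, DD_DD,
    neg_add_cancel, DD_zero, mul_one]

lemma Re.ex (f : R2) : ∃ s, Re f s := by
  let S : AddSubgroup R2 :=
    { carrier := {f | ∃ s, Re f s}
      zero_mem' := ⟨0, Re.zero⟩
      add_mem' := by
        rintro a b ⟨s, h⟩ ⟨s', h'⟩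
        exact ⟨_, h.mul h'⟩
      neg_mem' := by
        intro a h; rw [CharTwo.neg_eq]; exact h }
  exact all_ind S (fun i => ⟨_, Re.mono i⟩) f

lemma Re.sig (r : R2) : Re 0 (r + T 1 * cj r) := by
  let S : AddSubgroup R2 :=
    { carrier := {r | Re 0 (r + T 1 * cj r)}
      zero_mem' := Re.zero.congr rfl (by rw [cj_zero]; ring)
      add_mem' := by
        intro a b h h'
        exact (h.mul h').congr (by ring) (by rw [cj_add]; ring)
      neg_mem' := by
        intro a h; rw [CharTwo.neg_eq]; exact h }
  have h0 : (T 0 : R2) ∈ S := by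
    refine ((Re.mono 0).mul (Re.mono 0)).congr (add_self _) ?_
    simp only [cj_T, T_zero, neg_zero]; grind
  have h1 : ∀ i : ℤ, (T i + T (-i) : R2) ∈ S := by
    intro i
    have a := (Re.mono 0).mul (Re.mono i)
    refine (a.mul a).congr (add_self _) ?_
    have := T_cj i
    simp only [cj_add, cj_T, T_zero, neg_zero, neg_neg]; grind
  have h2 : ∀ i : ℤ, (T (i + 1) + T (-i) : R2) ∈ S := by
    intro i
    refine Re.zero.congr rfl ?_
    rw [cj_add, cj_T, cj_T, mul_add, T_T, T_T, show 1 + -(i+1) = -i by ring, show 1 + - -i = i+1 by ring]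
    grind
  have h3 : ∀ i : ℤ, (T (i + 1) + T i : R2) ∈ S := by
    intro i
    have := S.add_mem (h1 i) (h2 i)
    convert this using 1
    grind
  have : ∀ i : ℤ, (T i : R2) ∈ S := by
    intro i
    induction i with
    | zero => exact h0
    | succ n ih =>
      have := S.add_mem ih (h3 n)
      convert this using 1
      grind
    | pred n ih =>
      have := S.add_mem ih (h3 (-n - 1))
      convert this using 1
      rw [sub_add_cancel]
      grind
  exact all_ind S this r

lemma Re.of_val {f s : R2} (h : Val f s) : Re f s := by
  obtain ⟨s1, h1⟩ := Re.ex f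
  have v1 := h1.val
  obtain ⟨l, u, e, hu, hl⟩ := split 1 (s + s1)
  have key : u + T 1 * cj l = 0 := by
    have h2 : u + T 1 * cj l = l + T 1 * cj u := by
      have : cj l + cj u = cj s + cj s1 := by rw [← cj_add, ← e, cj_add]
      rw [Val] at h v1
      grind
    refine Ge_both (M := 1) (N := 0) (hu.add (hl.Tmul _ (by omega))) ?_ (by omega)
    rw [h2, cj_add, cj_mul, cj_cj, cj_T]
    exact (hl.mono (by omega)).add (hu.Tmul _ (by omega))
  refine (h1.mul (Re.sig l)).congr (add_zero _) ?_
  grind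

lemma stab_PK {g : F} (h : g ∈ StabL) : ∃ p ∈ HH, p⁻¹ * g ∈ KK := by
  obtain ⟨k, hk⟩ := h
  obtain ⟨l, b, f, s, hv, h⟩ := stab_form g _ hk
  obtain ⟨p, hp, hpn⟩ := Re.of_val hv
  refine ⟨p * ee ^ b, mul_mem hp (zpow_mem ee_HH _), l, fun w => ?_⟩
  rw [lin_mul, h, _root_.mul_inv_rev, lin_mul, ← hpn, ← lin_smul, lin_inv_l, ← lin_ee_zpow, lin_smul, lin_inv_l]

lemma comm_list {G : Type*} [Group G] {ι : Type*} (z : G) (a : ι → G)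
    (hz : ∀ i, a i * z = z * a i) (l : List ι) : (l.map a).prod * z = z * (l.map a).prod := by
  induction l with
  | nil => simp
  | cons i l ih => rw [List.map_cons, List.prod_cons, mul_assoc, ih, ← mul_assoc, hz, mul_assoc]

lemma list_even {G : Type*} [Group G] {ι : Type*} [DecidableEq ι] (Z : Subgroup G) (a : ι → G)
    (hsq : ∀ i, a i * a i ∈ Z) (hc : ∀ i j, ∃ z ∈ Z, a i * a j = a j * a i * z)
    (hz : ∀ z ∈ Z, ∀ i, a i * z = z * a i) (l : List ι) (he : ∀ i, Even (l.count i)) :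
    (l.map a).prod ∈ Z := by
  have move : ∀ i (l : List ι), ∃ z ∈ Z, a i * (l.map a).prod = (l.map a).prod * a i * z := by
    intro i l
    induction l with
    | nil => exact ⟨1, one_mem _, by simp⟩
    | cons j l ih =>
      obtain ⟨z, hz1, h⟩ := ih
      obtain ⟨z', hz2, h'⟩ := hc i j
      refine ⟨z * z', mul_mem hz1 hz2, ?_⟩
      have e1 := comm_list z' a (hz z' hz2) l
      have e2 := hz z' hz2 i
      have e3 : z * z' = z' * z ∨ True := Or.inr trivial
      rw [List.map_cons, List.prod_cons]
      calc a i * (a j * (l.map a).prod) = a j * a i * z' * (l.map a).prod := by rw [← mul_assoc, h']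
        _ = a j * (a i * (l.map a).prod) * z' := by
            rw [mul_assoc _ z', ← e1]; simp only [mul_assoc]
        _ = a j * (l.map a).prod * a i * (z * z') := by rw [h]; simp only [mul_assoc]
  obtain ⟨n, hn⟩ : ∃ n, l.length ≤ n := ⟨_, le_rfl⟩
  induction n generalizing l with
  | zero =>
    have : l = [] := List.length_eq_zero_iff.1 (by omega)
    subst this; simp
  | succ n ih =>
    cases l with
    | nil => simp
    | cons i l =>
      have hi : i ∈ l := by
        have := he i
        rw [List.count_cons_self] at this
        rw [← List.count_pos_iff]
        rcases Nat.eq_zero_or_pos (l.count i) with h | h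
        · rw [h] at this; simp at this
        · exact h
      obtain ⟨l1, l2, rfl⟩ := List.append_of_mem hi
      have := ih (l1 ++ l2) (by
        intro j
        have := he j
        simp only [List.count_cons, List.count_append] at this ⊢
        split_ifs at this
        · rw [Nat.even_iff] at this ⊢; omega
        · simpa using this) (by simp at hn ⊢; omega)
      obtain ⟨z, hz1, h⟩ := move i l1
      simp only [List.map_cons, List.map_append, List.prod_cons, List.prod_append] at this ⊢
      have hzz : a i * z * a i ∈ Z := by
        rw [mul_assoc, ← hz z hz1, ← mul_assoc]
        exact mul_mem (hsq i) hz1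
      have e := comm_list _ a (hz _ hzz) l2
      have : a i * ((l1.map a).prod * (a i * (l2.map a).prod)) = (l1.map a).prod * (l2.map a).prod * (a i * z * a i) := by
        rw [mul_assoc _ (l2.map a).prod, e, ← mul_assoc, h]; simp only [mul_assoc]
      rw [this]
      exact mul_mem ‹_› hzz

lemma x4_MM : fx ^ 4 ∈ MM := Subgroup.subset_normalClosure (by left; left; simp)
lemma y3_MM : fy ^ 3 ∈ MM := Subgroup.subset_normalClosure (by left; left; simp)
lemma cz_MM : br (fx ^ 2) zz ∈ MM := Subgroup.subset_normalClosure (by left; left; simp [zz])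
lemma bwn_zero : bwn 0 = 1 := by simp [bwn, br]
lemma b4_MM (i : ℕ) : bwn i ^ 4 ∈ MM := by
  rcases Nat.eq_zero_or_pos i with rfl | h
  · rw [bwn_zero]; simp
  · exact Subgroup.subset_normalClosure (by left; right; exact ⟨i, h, rfl⟩)
lemma bz_MM (i : ℕ) : br (bwn i ^ 2) zz ∈ MM := by
  rcases Nat.eq_zero_or_pos i with rfl | h
  · rw [bwn_zero]; simp [br]
  · exact Subgroup.subset_normalClosure (by right; exact ⟨i, h, rfl⟩)

abbrev GG : Type := F ⧸ MM
def ph : F →* GG := QuotientGroup.mk' MM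
lemma ph_one {g : F} : ph g = 1 ↔ g ∈ MM := QuotientGroup.eq_one_iff g

def gx : GG := ph fx
def gz : GG := ph zz

lemma gx4 : gx ^ 4 = 1 := by rw [gx, ← map_pow, ph_one]; exact x4_MM

lemma of_br {G : Type*} [Group G] {a b : G} (h : br a b = 1) : a * b = b * a := by
  have : a * b = b * a * br a b := by rw [br]; group
  rw [this, h, mul_one]

lemma ph_br (a b : F) : ph (br a b) = br (ph a) (ph b) := by simp [br]

lemma c_z : gx ^ 2 * gz = gz * gx ^ 2 := by
  apply of_br
  rw [gx, gz, ← map_pow, ← ph_br, ph_one]; exact cz_MM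

def gxj (j : ℤ) : GG := gz ^ (-j) * gx * gz ^ j

lemma ph_xj (j : ℤ) : ph (xj j) = gxj j := by simp [xj, gxj, gx, gz]

lemma comm_zpow {G : Type*} [Group G] {a b : G} (h : a * b = b * a) (j : ℤ) : a * b ^ j = b ^ j * a :=
  (Commute.zpow_right (show Commute a b from h) j).eq

lemma conj_comm {a : GG} (h : a * gz = gz * a) (j : ℤ) : gz ^ (-j) * a * gz ^ j = a := by
  rw [mul_assoc, comm_zpow h, ← mul_assoc, ← _root_.zpow_add]; simp

lemma gxj_sq (j : ℤ) : gxj j * gxj j = gx ^ 2 := by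
  have := conj_comm c_z j
  rw [← this, gxj, pow_two]; group

lemma gxj_c (j : ℤ) : gxj j * gx ^ 2 = gx ^ 2 * gxj j := by
  rw [← gxj_sq j, mul_assoc]

lemma c_c : gx ^ 2 * gx ^ 2 = 1 := by rw [← pow_add]; exact gx4

lemma gxj_inv (j : ℤ) : (gxj j)⁻¹ = gxj j * gx ^ 2 := by
  rw [inv_eq_iff_mul_eq_one, ← mul_assoc, gxj_sq, c_c]

lemma gxj_zero : gxj 0 = gx := by simp [gxj]

def gd (i : ℕ) : GG := ph (bwn i) ^ 2

lemma gb_eq (i : ℕ) : ph (bwn i) = gx * gxj i * gx ^ 2 := by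
  rw [bwn_eq, map_mul, map_inv, ph_xj, ← gx, ← gxj_zero, gxj_inv, mul_assoc, mul_assoc, gxj_zero, gxj_c]

lemma gd_eq (i : ℕ) : gd i = (gx * gxj i) * (gx * gxj i) := by
  have h1 := gxj_c i
  have h2 := gxj_c 0
  rw [gxj_zero] at h2
  have h3 : (gx * gxj i) * gx ^ 2 = gx ^ 2 * (gx * gxj i) := by
    rw [mul_assoc, h1, ← mul_assoc, h2, mul_assoc]
  rw [gd, gb_eq, pow_two]
  generalize gx * gxj i = u at *
  calc u * gx ^ 2 * (u * gx ^ 2) = u * (gx ^ 2 * u) * gx ^ 2 := by simp only [mul_assoc]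
    _ = u * (u * gx^2) * gx ^2 := by rw [h3]
    _ = u * u * (gx ^ 2 * gx ^ 2) := by simp only [mul_assoc]
    _ = _ := by rw [c_c, mul_one]

lemma gd_sq (i : ℕ) : gd i * gd i = 1 := by
  rw [gd, ← pow_add, ← map_pow, ph_one]; exact b4_MM i

lemma gd_z (i : ℕ) : gd i * gz = gz * gd i := by
  apply of_br
  rw [gd, gz, ← map_pow, ← ph_br, ph_one]; exact bz_MM i

lemma inv_xx (i : ℕ) : (gxj i * gx)⁻¹ = gx * gxj i := by
  have h1 := gxj_c i
  rw [_root_.mul_inv_rev, ← gxj_zero, gxj_inv, gxj_inv, gxj_zero, mul_assoc, h1, ← mul_assoc (gx ^ 2), c_c, one_mul]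

lemma swap (i : ℕ) : gx * gxj i = gxj i * gx * gd i := by
  rw [gd_eq, ← inv_xx]; group

lemma gd_x (i : ℕ) : gd i * gx = gx * gd i := by
  have h1 : gd i * gx = gx * ((gxj i * gx) * (gxj i * gx)) := by rw [gd_eq]; simp only [mul_assoc]
  have h2 : (gxj i * gx) * (gxj i * gx) = (gd i)⁻¹ := by rw [gd_eq, ← inv_xx]; group
  rw [h1, h2, inv_eq_of_mul_eq_one_left (gd_sq i)]

/-- generators of the centre -/
def cdF : ℕ → F
  | 0 => fx ^ 2
  | i + 1 => bwn (i + 1) ^ 2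

def cd (i : ℕ) : GG := ph (cdF i)

lemma cd_zero : cd 0 = gx ^ 2 := by simp [cd, cdF, gx]
lemma cd_succ (i : ℕ) : cd (i + 1) = gd (i + 1) := by simp [cd, cdF, gd]

lemma cd_x (i : ℕ) : cd i * gx = gx * cd i := by
  cases i with
  | zero => rw [cd_zero]; group
  | succ i => rw [cd_succ, gd_x]

lemma cd_z (i : ℕ) : cd i * gz = gz * cd i := by
  cases i with
  | zero => rw [cd_zero, c_z]
  | succ i => rw [cd_succ, gd_z]

lemma cd_sq (i : ℕ) : cd i * cd i = 1 := by
  cases i with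
  | zero => rw [cd_zero, c_c]
  | succ i => rw [cd_succ, gd_sq]

def Zc : Subgroup GG := Subgroup.closure (Set.range cd)

lemma Zc_comm {a : GG} (ha : ∀ i, cd i * a = a * cd i) {g : GG} (hg : g ∈ Zc) : a * g = g * a := by
  have : Zc ≤ Subgroup.centralizer {a} := by
    rw [Zc, Subgroup.closure_le]
    rintro _ ⟨i, rfl⟩
    rw [SetLike.mem_coe, Subgroup.mem_centralizer_singleton_iff]
    exact (ha i)
  have h := this hg
  rw [Subgroup.mem_centralizer_singleton_iff] at h
  exact h.symm

lemma cd_xj (i : ℕ) (j : ℤ) : cd i * gxj j = gxj j * cd i := by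
  have h : Commute (cd i) gz := cd_z i
  have h' : Commute (cd i) gx := cd_x i
  exact (((h.zpow_right (-j)).mul_right h').mul_right (h.zpow_right j)).eq

lemma cd_cd (i j : ℕ) : cd i * cd j = cd j * cd i := by
  cases j with
  | zero =>
    have h : Commute (cd i) gx := cd_x i
    rw [cd_zero]; exact (h.pow_right 2).eq
  | succ j =>
    have h : Commute (cd i) gx := cd_x i
    have h' : Commute (cd i) (gxj (j+1 : ℕ)) := cd_xj i _
    rw [cd_succ, gd_eq]
    exact ((h.mul_right h').mul_right (h.mul_right h')).eq

lemma gd_Zc (i : ℕ) : gd i ∈ Zc := by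
  cases i with
  | zero => rw [gd, bwn_zero, map_one]; simp
  | succ i => rw [← cd_succ]; exact Subgroup.subset_closure ⟨_, rfl⟩

lemma gxj_swap (j : ℤ) (i : ℕ) : gxj j * gxj (j + i) = gxj (j + i) * gxj j * gd i := by
  have e : gxj (j + i) = gz ^ (-j) * gxj i * gz ^ j := by
    rw [gxj, gxj, neg_add, _root_.zpow_add, _root_.zpow_add]
    rw [(show gz ^ j * gz ^ (i:ℤ) = gz ^ (i:ℤ) * gz ^ j by rw [← _root_.zpow_add, ← _root_.zpow_add, add_comm])]
    simp only [mul_assoc]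
  have h1 : gxj j * gxj (j + i) = gz ^ (-j) * (gx * gxj i) * gz ^ j := by
    rw [e, gxj]; group
  rw [h1, swap, e]
  have h2 := conj_comm (gd_z i) j
  have h3 := comm_zpow (gd_z i) j
  rw [mul_assoc, mul_assoc _ (gd i), h3]
  have e' : gxj j = gz ^ (-j) * gx * gz ^ j := rfl
  rw [e']
  generalize gxj i = u
  generalize gd i = v
  group

lemma gxj_hc (i j : ℤ) : ∃ z ∈ Zc, gxj i * gxj j = gxj j * gxj i * z := by
  rcases le_total i j with h | h
  · obtain ⟨n, rfl⟩ := Int.le.dest h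
    exact ⟨gd n, gd_Zc n, gxj_swap i n⟩
  · obtain ⟨n, rfl⟩ := Int.le.dest h
    exact ⟨(gd n)⁻¹, inv_mem (gd_Zc n), by rw [gxj_swap]; group⟩

lemma gxj_list {l : List ℤ} (he : ∀ i, Even (l.count i)) : (l.map gxj).prod ∈ Zc := by
  refine list_even Zc gxj ?_ gxj_hc ?_ l he
  · intro i; rw [gxj_sq, ← cd_zero]; exact Subgroup.subset_closure ⟨_, rfl⟩
  · intro z hz i
    exact Zc_comm (fun k => cd_xj k i) hz

lemma cd_list {l : List ℕ} (he : ∀ i, Even (l.count i)) : (l.map cd).prod = 1 := by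
  have := list_even ⊥ cd (fun i => cd_sq i) (fun i j => ⟨1, one_mem _, by rw [cd_cd, mul_one]⟩) ?_ l he
  · exact this
  · intro z hz i
    rw [Subgroup.mem_bot] at hz; subst hz; simp

lemma Zc_form {g : GG} (hg : g ∈ Zc) : ∃ l : List ℕ, g = (l.map cd).prod := by
  induction hg using Subgroup.closure_induction_right with
  | one => exact ⟨[], by simp⟩
  | mul_right g hg s hs ih =>
    obtain ⟨l, rfl⟩ := ih
    obtain ⟨i, rfl⟩ := hs
    exact ⟨l ++ [i], by simp⟩
  | mul_inv_cancel g hg s hs ih =>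
    obtain ⟨l, rfl⟩ := ih
    obtain ⟨i, rfl⟩ := hs
    exact ⟨l ++ [i], by simp [inv_eq_of_mul_eq_one_left (cd_sq i)]⟩

lemma shift_list (l : List ℤ) (j : ℤ) : (l.map gxj).prod * gz ^ j = gz ^ j * ((l.map (· + j)).map gxj).prod := by
  induction l with
  | nil => simp
  | cons i l ih =>
    simp only [List.map_cons, List.prod_cons]
    rw [mul_assoc, ih, ← mul_assoc, ← mul_assoc]
    congr 1
    simp only [gxj]
    rw [neg_add, _root_.zpow_add, _root_.zpow_add]
    group

lemma HH_form {g : F} (hg : g ∈ HH) : ∃ (k : ℤ) (l : List ℤ), ph g = gz ^ k * (l.map gxj).prod := by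
  induction hg using Subgroup.closure_induction_right with
  | one => exact ⟨0, [], by simp⟩
  | mul_right g hg s hs ih =>
    obtain ⟨k, l, h⟩ := ih
    rcases hs with rfl | rfl
    · exact ⟨k, l ++ [0], by rw [map_mul, h, ← gx]; simp [gxj_zero, mul_assoc]⟩
    · refine ⟨k + 1, l.map (· + 1), ?_⟩
      have := shift_list l 1
      rw [zpow_one] at this
      rw [map_mul, h, ← gz, mul_assoc, this, ← mul_assoc, _root_.zpow_add_one]
  | mul_inv_cancel g hg s hs ih =>
    obtain ⟨k, l, h⟩ := ih
    rcases hs with rfl | rfl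
    · refine ⟨k, l ++ [0, 0, 0], ?_⟩
      have := gxj_inv 0
      rw [gxj_zero] at this
      rw [map_mul, map_inv, h, ← gx, this]; simp [gxj_zero, mul_assoc, pow_two]
    · refine ⟨k - 1, l.map (· + (-1)), ?_⟩
      have := shift_list l (-1)
      rw [_root_.zpow_neg_one] at this
      rw [map_mul, map_inv, h, ← gz, mul_assoc, this, ← mul_assoc, _root_.zpow_sub_one]

def Tri (k : ℤ) (g : F) : Prop := ∃ f s, ∀ w, lin g w = nn f s (DD k w)

lemma DD_nn' (j : ℤ) (f s : R2) (w : V) : DD j (nn f s w) = nn (T (-j) * f) s (DD j w) := by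
  have := DD_nn (-j) f s w
  rwa [neg_neg] at this

lemma Tri.mul {k k' : ℤ} {g g' : F} (h : Tri k g) (h' : Tri k' g') : Tri (k + k') (g * g') := by
  obtain ⟨f, s, h⟩ := h
  obtain ⟨f', s', h'⟩ := h'
  exact ⟨_, _, fun w => by rw [lin_mul, h', h, DD_nn', nn_nn, DD_DD]⟩

lemma Uni.tri {f : R2} {g : F} (h : Uni f g) : Tri 0 g := by
  obtain ⟨s, h⟩ := h
  exact ⟨f, s, fun w => by rw [h, DD_zero]⟩

lemma tri_z (k : ℤ) : Tri k (zz ^ k) := by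
  have he : ∀ j : ℤ, Tri j (ee ^ j) := fun j => ⟨0, 0, fun w => by rw [lin_ee_zpow, nn_zero]⟩
  induction k with
  | zero => rw [zpow_zero]; exact uni_one.tri
  | succ n ih =>
    have := ih.mul ((he 1).mul uni_x.inv.tri)
    rw [show zz ^ ((n : ℤ) + 1) = zz ^ (n : ℤ) * (ee ^ (1 : ℤ) * fx⁻¹) by rw [ee]; group]
    exact this
  | pred n ih =>
    have := ih.mul (uni_x.tri.mul (he (-1)))
    rw [show zz ^ (-(n : ℤ) - 1) = zz ^ (-(n : ℤ)) * (fx * ee ^ (-1 : ℤ)) by rw [ee]; group]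
    rw [show -(n : ℤ) - 1 = -(n : ℤ) + (0 + -1) by ring]
    exact this

lemma T_inj {a b : ℤ} (h : (T a : R2) = T b) : a = b := by
  refine ord_uniq (p := T a) (by rw [add_self]; exact Ge.zero _) (by rw [h, add_self]; exact Ge.zero _)

lemma Tri.KK {k : ℤ} {g : F} (h : Tri k g) (hg : g ∈ KK) : k = 0 ∧ ∀ w, lin g w = w := by
  obtain ⟨f, s, h⟩ := h
  obtain ⟨m, hm⟩ := hg
  have a1 := (h e1).symm.trans (hm e1)
  have a2 := (h e2).symm.trans (hm e2)
  simp [nn, DD] at a1 a2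
  have b2 : m = 0 := T_inj (by rw [T_zero]; exact a2.2.symm)
  have b1 := T_inj a1
  refine ⟨by omega, fun w => ?_⟩
  rw [hm, b2, T_zero, one_smul]

lemma uni_list (l : List ℤ) : Uni ((l.map (fun j => (T j : R2))).sum) ((l.map xj).prod) := by
  induction l with
  | nil => exact uni_one
  | cons i l ih =>
    simp only [List.map_cons, List.prod_cons, List.sum_cons]
    exact (uni_xj i).mul ih

lemma coeff_list (l : List ℤ) (i : ℤ) : ((l.map (fun j => (T j : R2))).sum).coeff i = (l.count i : ZMod 2) := by
  induction l with
  | nil => simp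
  | cons j l ih =>
    rw [List.map_cons, List.sum_cons, AddMonoidAlgebra.coeff_add, Finsupp.add_apply, ih, T_apply, List.count_cons]
    by_cases h : j = i
    · subst h; simp [add_comm]
    · simp [h]

def qi : ℕ → R2
  | 0 => 1
  | i + 1 => T (i + 1 : ℕ) + T (-(i + 1 : ℕ))

lemma cen_cd (i : ℕ) : Cen ((1 + T 1) * qi i) (cdF i) := by
  cases i with
  | zero =>
    intro w
    rw [cdF, uni_x.sq]; simp [qi]
  | succ i =>
    intro w
    rw [cdF, (uni_bwn (i+1)).sq, qi]
    congr 1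
    rw [cj_add, cj_one, cj_T, mul_assoc]
    congr 1
    have := T_cj (i+1 : ℕ)
    grind

lemma cen_list (l : List ℕ) : Cen ((1 + T 1) * (l.map qi).sum) ((l.map cdF).prod) := by
  induction l with
  | nil => intro w; simp [nn_zero, lin_one]
  | cons i l ih =>
    intro w
    simp only [List.map_cons, List.prod_cons, List.sum_cons]
    rw [lin_mul, ih, cen_cd, nn_nn]
    congr 1 <;> simp only [cj_zero] <;> ring

lemma coeff_qi (l : List ℕ) (i : ℕ) : ((l.map qi).sum).coeff (i : ℤ) = (l.count i : ZMod 2) := by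
  induction l with
  | nil => simp
  | cons j l ih =>
    rw [List.map_cons, List.sum_cons, AddMonoidAlgebra.coeff_add, Finsupp.add_apply, ih, List.count_cons]
    have : (qi j).coeff (i : ℤ) = if j = i then 1 else 0 := by
      cases j with
      | zero =>
        rw [qi, ← T_zero, T_apply]
        congr 1
        simp [eq_comm]
      | succ j =>
        rw [qi, AddMonoidAlgebra.coeff_add, Finsupp.add_apply, T_apply, T_apply, if_neg (show ¬ (-((j+1 : ℕ):ℤ) = (i:ℤ)) by omega), add_zero]
        congr 1
        simp only [eq_iff_iff]; omega
    rw [this]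
    by_cases h : j = i
    · subst h; simp [add_comm]
    · simp [h]

lemma even_of {n : ℕ} (h : (n : ZMod 2) = 0) : Even n := by
  rwa [ZMod.natCast_eq_zero_iff_even] at h

lemma HH_KK {g : F} (hg : g ∈ HH) (hk : g ∈ KK) : g ∈ MM := by
  obtain ⟨k, l, h⟩ := HH_form hg
  have conv : ∀ {a b : F}, ph a = ph b → a ∈ KK → b ∈ KK := by
    intro a b e ha
    have : a⁻¹ * b ∈ MM := by rw [← ph_one, map_mul, map_inv, e, inv_mul_cancel]
    have h2 := mul_mem ha (MM_KK this)
    rwa [mul_inv_cancel_left] at h2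
  have e1 : ph g = ph (zz ^ k * (l.map xj).prod) := by
    rw [h, map_mul, map_zpow, ← gz, map_list_prod, List.map_map]
    congr 3
  have k1 := conv e1 hk
  obtain ⟨hk0, hlin⟩ := ((tri_z k).mul (uni_list l).tri).KK k1
  rw [add_zero] at hk0
  subst hk0
  rw [zpow_zero, one_mul] at hlin h
  have hs := (uni_list l).uniq ⟨0, fun w => by rw [hlin, nn_zero]⟩
  have hZ : ph g ∈ Zc := by
    rw [h]
    refine gxj_list fun i => even_of ?_
    rw [← coeff_list, hs]; simp
  obtain ⟨l', hl'⟩ := Zc_form hZ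
  have e2 : ph g = ph ((l'.map cdF).prod) := by
    rw [hl', map_list_prod, List.map_map]; rfl
  obtain ⟨m, hm⟩ := conv e2 hk
  have a3 := (cen_list l' e3).symm.trans (hm e3)
  simp [nn] at a3
  have h0 : (l'.map qi).sum = 0 := by
    rcases a3.1 with h | h
    · exact absurd h opt_ne
    · exact h
  rw [← ph_one, hl']
  refine cd_list fun i => even_of ?_
  rw [← coeff_qi, h0]; simp

lemma PF_form {g : F} (hg : g ∈ PF) : ∃ h ∈ HH, ∃ m ∈ MM, g = h * m := by
  rw [PF, ← SetLike.mem_coe, Subgroup.mul_normal] at hg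
  obtain ⟨h, hh, m, hm, e⟩ := hg
  exact ⟨h, hh, m, hm, e.symm⟩

lemma PF_KK {g : F} (hg : g ∈ PF) (hk : g ∈ KK) : g ∈ MM := by
  obtain ⟨h, hh, m, hm, rfl⟩ := PF_form hg
  refine mul_mem (HH_KK hh ?_) hm
  have := mul_mem hk (inv_mem (MM_KK hm))
  rwa [mul_inv_cancel_right] at this

abbrev LV : Type := AddSubgroup V

def GeV (K : ℤ) (w : V) : Prop := Ge K w.1 ∧ Ge K w.2.1 ∧ Ge K w.2.2

lemma GeV.mono {K L : ℤ} {w : V} (h : GeV K w) (hl : L ≤ K) : GeV L w :=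
  ⟨h.1.mono hl, h.2.1.mono hl, h.2.2.mono hl⟩

lemma GeV.add {K : ℤ} {v w : V} (h : GeV K v) (h' : GeV K w) : GeV K (v + w) :=
  ⟨h.1.add h'.1, h.2.1.add h'.2.1, h.2.2.add h'.2.2⟩

lemma GeV.smul {K L N : ℤ} {c : R2} {w : V} (hc : Ge L c) (h : GeV K w) (hN : N ≤ L + K) : GeV N (c • w) :=
  ⟨hc.mul' h.1 hN, hc.mul' h.2.1 hN, hc.mul' h.2.2 hN⟩

lemma ex_GeV (w : V) : ∃ N, GeV N w := by
  obtain ⟨a, ha⟩ := ex_Ge w.1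
  obtain ⟨b, hb⟩ := ex_Ge w.2.1
  obtain ⟨c, hc⟩ := ex_Ge w.2.2
  exact ⟨min a (min b c), ha.mono (by omega), hb.mono (by omega), hc.mono (by omega)⟩

def TC (Λ : LV) : Prop := ∀ w ∈ Λ, (T 1 : R2) • w ∈ Λ

def Bd (Λ : LV) : Prop := ∃ K : ℤ, (∀ w, GeV K w → w ∈ Λ) ∧ ∀ w ∈ Λ, GeV (-K) w

def IsLat (Λ : LV) : Prop := TC Λ ∧ Bd Λ

lemma TC.T {Λ : LV} (h : TC Λ) {w : V} (hw : w ∈ Λ) {i : ℤ} (hi : 0 ≤ i) : (T i : R2) • w ∈ Λ := by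
  obtain ⟨n, rfl⟩ := Int.eq_ofNat_of_zero_le hi
  clear hi
  induction n with
  | zero => simpa [T_zero] using hw
  | succ n ih =>
    have := h _ ih
    rwa [smul_smul, T_T, add_comm] at this

lemma TC.smul {Λ : LV} (h : TC Λ) {w : V} (hw : w ∈ Λ) {c : R2} (hc : Ge 0 c) : c • w ∈ Λ := by
  let S : AddSubgroup R2 :=
    { carrier := {c | c • w ∈ Λ}
      zero_mem' := by simp
      add_mem' := by
        intro a b ha hb
        have := Λ.add_mem ha hb
        rwa [← add_smul] at this
      neg_mem' := by intro a ha; rw [CharTwo.neg_eq]; exact ha }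
  exact Ge_ind S (fun i hi => h.T hw hi) hc

lemma ideal (I : AddSubgroup R2) (ht : ∀ p ∈ I, T 1 * p ∈ I) (K : ℤ) (h1 : ∀ p, Ge K p → p ∈ I)
    (h2 : ∀ p ∈ I, Ge (-K) p) : ∃ b, ∀ p, p ∈ I ↔ Ge b p := by
  have hT : ∀ (n : ℕ), ∀ p ∈ I, T n * p ∈ I := by
    intro n p hp
    induction n with
    | zero => simpa [T_zero] using hp
    | succ n ih =>
      have := ht _ ih
      rwa [← mul_assoc, T_T, add_comm] at this
  have key : ∀ M p, p ∈ I → Ge (M+1) (p + T M) → ∀ q, Ge M q → q ∈ I := by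
    intro M p hp ho
    have : ∀ d : ℕ, ∀ n : ℕ, K - M ≤ n + d → ∀ q, Ge (M + n) q → q ∈ I := by
      intro d
      induction d with
      | zero => intro n hn q hq; exact h1 q (hq.mono (by push_cast at hn; omega))
      | succ d ih =>
        intro n hn
        have ih' := ih (n+1) (by push_cast at hn ⊢; omega)
        have hTn : T (M + n) ∈ I := by
          have a := hT n p hp
          have b := ih' (T n * (p + T M)) (ho.Tmul _ (by push_cast; omega))
          have c := I.add_mem a b
          convert c using 1
          rw [mul_add, T_T, add_comm (n : ℤ) M]; grind
        intro q hq
        rcases Ge_succ hq with h | h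
        · exact ih' q (h.mono (by push_cast; omega))
        · have := I.add_mem (ih' _ (h.mono (by push_cast; omega))) hTn
          rwa [add_assoc, add_self, add_zero] at this
    intro q hq
    exact this (K - M).toNat 0 (by push_cast; omega) q (by simpa using hq)
  obtain ⟨B, hB, hmax⟩ := Int.exists_greatest_of_bdd (P := fun B => ∀ p ∈ I, Ge B p)
    ⟨K, fun z hz => Ge_T.1 (hz _ (h1 _ (Ge.of_T le_rfl)))⟩ ⟨-K, h2⟩
  refine ⟨B, fun p => ⟨hB p, ?_⟩⟩
  have : ∃ q ∈ I, ¬ Ge (B+1) q := by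
    by_contra! hc
    have := hmax (B+1) hc
    omega
  obtain ⟨q, hq, hn⟩ := this
  rcases Ge_succ (hB q hq) with h | h
  · exact absurd h hn
  · exact key B q hq h p

lemma geom (p : R2) (N : ℤ) : ∃ m, Ge N ((1 + T 1) * m + p) := by
  have : ∀ L : ℕ, ∃ m, (1 + T 1) * m + p = T L * p := by
    intro L
    induction L with
    | zero => exact ⟨0, by simp [T_zero]⟩
    | succ L ih =>
      obtain ⟨m, hm⟩ := ih
      refine ⟨m + T L * p, ?_⟩
      have : (T ((L + 1 : ℕ) : ℤ) : R2) = T L * T 1 := by rw [T_T]; push_cast; rfl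
      rw [this]
      grind
  obtain ⟨M, hM⟩ := ex_Ge p
  obtain ⟨m, hm⟩ := this (N - M).toNat
  exact ⟨m, by rw [hm]; exact hM.Tmul _ (by omega)⟩

/-- the core predicate -/
def CC (u : V) (Λ : LV) : Prop := ∃ k : ℤ, (T k : R2) • u ∈ Λ ∧ ∀ w ∈ Λ, Ge (k + 1) (hh w u)

lemma hh_add_left (v w u : V) : hh (v + w) u = hh v u + hh w u := by
  simp only [hh, Prod.fst_add, Prod.snd_add]; ring

lemma hh_e1 (w : V) : hh w e1 = T 1 * w.2.2 := by
  simp [hh]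

lemma hh_u (w : V) (s f : R2) : hh w (s, f, 1) = w.1 + (1 + T 1) * w.2.1 * cj f + T 1 * w.2.2 * cj s := by
  simp only [hh, cj_one, mul_one]

lemma lemD {Λ : LV} (hL : IsLat Λ) (k : ℤ) (h1 : (T (k + 1) : R2) • e1 ∈ Λ)
    (h2 : ∀ w ∈ Λ, Ge k w.2.2) : CC e1 Λ ∨ ∃ f s, Val f s ∧ CC (s, f, 1) Λ := by
  obtain ⟨ht, K, hK1, hK2⟩ := hL
  by_cases c1 : (T k : R2) • e1 ∈ Λ
  · left; refine ⟨k, c1, fun w hw => ?_⟩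
    rw [hh_e1]; exact (h2 w hw).Tmul _ (by omega)
  by_cases c2 : ∀ w ∈ Λ, Ge (k + 1) w.2.2
  · left; refine ⟨k + 1, h1, fun w hw => ?_⟩
    rw [hh_e1]; exact (c2 w hw).Tmul _ (by omega)
  right
  push Not at c2
  obtain ⟨W0, hW0, hW0'⟩ := c2
  -- the three ideals
  let I3 : AddSubgroup R2 := Λ.map ((AddMonoidHom.snd R2 R2).comp (AddMonoidHom.snd R2 (R2 × R2)))
  let I1 : AddSubgroup R2 := Λ.comap (AddMonoidHom.inl R2 (R2 × R2))
  let I2 : AddSubgroup R2 :=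
    { carrier := {b | ∃ a, ((a, b, 0) : V) ∈ Λ}
      zero_mem' := ⟨0, Λ.zero_mem⟩
      add_mem' := by
        rintro a b ⟨c, hc⟩ ⟨d, hd⟩
        exact ⟨c + d, by simpa using Λ.add_mem hc hd⟩
      neg_mem' := by intro a h; rw [CharTwo.neg_eq]; exact h }
  have i3 : ∃ b, ∀ p, p ∈ I3 ↔ Ge b p := by
    refine ideal I3 ?_ K ?_ ?_
    · rintro _ ⟨w, hw, rfl⟩
      exact ⟨_, ht w hw, rfl⟩
    · intro p hp
      exact ⟨(0, 0, p), hK1 _ ⟨Ge.zero _, Ge.zero _, hp⟩, rfl⟩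
    · rintro _ ⟨w, hw, rfl⟩
      exact (hK2 w hw).2.2
  have i1 : ∃ b, ∀ p, p ∈ I1 ↔ Ge b p := by
    refine ideal I1 ?_ K ?_ ?_
    · intro p hp
      have := ht _ hp
      simpa [I1] using this
    · intro p hp
      exact hK1 _ ⟨hp, Ge.zero _, Ge.zero _⟩
    · intro p hp
      exact (hK2 _ hp).1
  have i2 : ∃ b, ∀ p, p ∈ I2 ↔ Ge b p := by
    refine ideal I2 ?_ K ?_ ?_
    · rintro p ⟨a, ha⟩
      have := ht _ ha
      exact ⟨T 1 * a, by simpa using this⟩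
    · intro p hp
      exact ⟨0, hK1 _ ⟨Ge.zero _, hp, Ge.zero _⟩⟩
    · rintro p ⟨a, hp⟩
      exact (hK2 _ hp).2.1
  obtain ⟨b3, i3⟩ := i3
  obtain ⟨b1, i1⟩ := i1
  obtain ⟨b, i2⟩ := i2
  have hb3 : b3 ≤ k := by
    by_contra hc
    exact hW0' (((i3 W0.2.2).1 ⟨W0, hW0, rfl⟩).mono (by omega))
  have hb1 : b1 = k + 1 := by
    apply le_antisymm
    · apply Ge_T.1
      refine (i1 _).1 ?_
      change ((T (k+1), 0, 0) : V) ∈ Λ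
      simpa using h1
    · by_contra hc
      apply c1
      have this : ((T k, 0, 0) : V) ∈ Λ := (i1 (T k)).2 (Ge.of_T (by omega))
      simpa using this
  subst hb1
  obtain ⟨W, hW, hWe⟩ := (i3 (T k)).2 (Ge.of_T hb3)
  obtain ⟨la, nu, W3⟩ := W
  change W3 = T k at hWe
  subst hWe
  obtain ⟨mu, hE⟩ := (i2 (T b)).2 (Ge.of_T le_rfl)
  have hA : ∀ a : R2, Ge (k+1) a → ((a, 0, 0) : V) ∈ Λ := fun a ha => (i1 a).2 ha
  -- choose f
  obtain ⟨l1, u1, eν, hu1, hl1⟩ := split (b - k) (T (-k) * nu)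
  obtain ⟨m, hm⟩ := geom (T (-b) * mu) (k + 1 - b)
  obtain ⟨l2, u2, em, hu2, hl2⟩ := split (b - k) (cj m)
  obtain ⟨f, hf⟩ : ∃ f, f = l1 + u2 := ⟨_, rfl⟩
  have Tb := T_cj b
  have Tk := T_cj k
  obtain ⟨κ, hκ⟩ : ∃ κ, κ = T (-b) * (T k * (u1 + u2)) := ⟨_, rfl⟩
  have hκ0 : Ge 0 κ := by
    rw [hκ]; exact ((hu1.add hu2).Tmul (L := b) k (by omega)).Tmul _ (by omega)
  have eκ : nu + κ * T b = T k * f := by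
    have : nu = T k * (l1 + u1) := by rw [← eν]; grind
    rw [hκ, this, hf]; grind
  have hEu : Ge (k + 1) (mu + (1 + T 1) * T b * cj f) := by
    have e1 : m = cj l2 + cj u2 := by rw [← cj_add, ← em, cj_cj]
    have e2 : mu + (1 + T 1) * T b * cj f
        = T b * ((1 + T 1) * m + T (-b) * mu) + T b * ((1 + T 1) * (cj l1 + cj l2)) := by
      rw [hf, cj_add, e1]
      generalize cj l1 = L1
      generalize cj l2 = L2
      generalize cj u2 = U2
      grind
    rw [e2]
    exact (hm.Tmul _ (by omega)).add ((Ge_opt.mul (hl1.add hl2)).Tmul _ (by omega))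
  -- choose s
  obtain ⟨rl, ru, er, hru, hrl⟩ := split 1 ((1 + T 1) * f * cj f)
  have hr : rl = T 1 * cj ru := by
    have h3 : rl + T 1 * cj ru = ru + T 1 * cj rl := by
      have a1 : cj rl + cj ru = (1 + T (-1)) * cj f * f := by
        rw [← cj_add, ← er]; simp only [cj_mul, cj_add, cj_one, cj_T, cj_cj]
      have := tt1
      generalize cj rl = RL at *
      generalize cj ru = RU at *
      generalize cj f = ff at *
      grind
    refine eq_of_add ?_
    refine Ge_both (M := 1) (N := 0) ?_ ?_ (by omega)
    · rw [h3]; exact hru.add (hrl.Tmul _ (by omega))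
    · rw [cj_add, cj_mul, cj_cj, cj_T]
      exact (hrl.mono (by omega)).add (hru.Tmul _ (by omega))
  obtain ⟨s0, q, eq, hq, hs0⟩ := split 1 (T (-k) * (la + κ * mu))
  obtain ⟨s, hs⟩ : ∃ s, s = s0 + T 1 * cj s0 + ru := ⟨_, rfl⟩
  have hv : Val f s := by
    rw [Val, er, hr, hs]
    simp only [cj_add, cj_mul, cj_T, cj_cj]
    have := tt1
    grind
  obtain ⟨a, ha⟩ : ∃ a, a = T k * s + (la + κ * mu) := ⟨_, rfl⟩
  have hGa : Ge (k + 1) a := by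
    have : a = T k * (T 1 * cj s0 + ru + q) := by
      have e : la + κ * mu = T k * (s0 + q) := by rw [← eq]; grind
      rw [ha, e, hs]; grind
    rw [this]
    exact (((hs0.Tmul _ (by omega)).add hru).add hq).Tmul _ (by omega)
  have hu : (T k : R2) • ((s, f, 1) : V) = ((la, nu, T k) : V) + κ • ((mu, T b, 0) : V) + ((a, 0, 0) : V) := by
    refine V_ext ?_ ?_ ?_
    · simp only [Prod.fst_add, Prod.smul_fst, smul_eq_mul, ha]; grind
    · simp only [Prod.fst_add, Prod.snd_add, Prod.smul_fst, Prod.smul_snd, smul_eq_mul]; rw [eκ, add_zero]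
    · simp
  have hhE : Ge (k + 1) (hh (mu, T b, 0) (s, f, 1)) := by
    rw [hh_u]; simpa using hEu
  have hhA : ∀ a : R2, Ge (k+1) a → Ge (k + 1) (hh (a, 0, 0) (s, f, 1)) := by
    intro a ha
    rw [hh_u]; simpa using ha
  have hhW : Ge (k + 1) (hh (la, nu, T k) (s, f, 1)) := by
    have h0 : hh (s, f, 1) (s, f, 1) = 0 := by
      rw [hh_u]; rw [Val] at hv; simp only [mul_one]; grind
    have h3 := congrArg (fun v => hh v (s, f, 1)) hu
    simp only [hh_add_left, hh_smul_left, h0, mul_zero] at h3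
    have h4 : hh (la, nu, T k) (s, f, 1) = κ * hh (mu, T b, 0) (s, f, 1) + hh (a, 0, 0) (s, f, 1) := by
      refine eq_of_add ?_
      rw [← add_assoc]; exact h3.symm
    rw [h4]
    exact (hκ0.mul' hhE (by omega)).add (hhA a hGa)
  refine ⟨f, s, hv, k, ?_, ?_⟩
  · rw [hu]
    exact Λ.add_mem (Λ.add_mem hW (TC.smul ht hE hκ0)) (hA a hGa)
  · intro w hw
    -- w = α W + β E + (a,0,0)
    obtain ⟨α, hα⟩ : ∃ α, α = T (-k) * w.2.2 := ⟨_, rfl⟩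
    have hα0 : Ge 0 α := by rw [hα]; exact (h2 w hw).Tmul _ (by omega)
    have m1 : w + α • ((la, nu, T k) : V) ∈ Λ := Λ.add_mem hw (TC.smul ht hW hα0)
    have e3 : (w + α • ((la, nu, T k) : V)).2.2 = 0 := by
      simp only [Prod.snd_add, Prod.smul_snd, smul_eq_mul, hα]; grind
    obtain ⟨w1, w2, w3, ew⟩ : ∃ a b c, w + α • ((la, nu, T k) : V) = (a, b, c) := ⟨_, _, _, rfl⟩
    rw [ew] at m1 e3
    change w3 = 0 at e3
    subst e3
    have g2 : Ge b w2 := (i2 w2).1 ⟨w1, m1⟩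
    obtain ⟨β, hβ⟩ : ∃ β, β = T (-b) * w2 := ⟨_, rfl⟩
    have hβ0 : Ge 0 β := by rw [hβ]; exact g2.Tmul _ (by omega)
    have m2 := Λ.add_mem m1 (TC.smul ht hE hβ0)
    have e4 : ((w1, w2, 0) : V) + β • ((mu, T b, 0) : V) = (w1 + β * mu, 0, 0) := by
      refine V_ext ?_ ?_ ?_
      · simp
      · simp only [Prod.fst_add, Prod.snd_add, Prod.smul_fst, Prod.smul_snd, smul_eq_mul, hβ]; grind
      · simp
    rw [e4] at m2
    have g1 := hhA _ ((i1 _).1 m2)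
    rw [← e4, ← ew, hh_add_left, hh_add_left, hh_smul_left, hh_smul_left] at g1
    have := (g1.add (hα0.mul' hhW (L := k + 1) (by omega))).add (hβ0.mul' hhE (L := k + 1) (by omega))
    convert this using 1
    grind

def AA (g : F) : Prop := g ∈ PF ∨ ∃ p ∈ PF, ∃ q ∈ PF, g = p * fy * q

lemma x_PF : fx ∈ PF := HH_PF x_HH
lemma z_PF : zz ∈ PF := HH_PF z_HH

lemma AA.left {g p : F} (hp : p ∈ PF) (h : AA g) : AA (p * g) := by
  rcases h with h | ⟨a, ha, b, hb, rfl⟩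
  · exact Or.inl (mul_mem hp h)
  · exact Or.inr ⟨p * a, mul_mem hp ha, b, hb, by simp only [mul_assoc]⟩

lemma AA.right {g p : F} (hp : p ∈ PF) (h : AA g) : AA (g * p) := by
  rcases h with h | ⟨a, ha, b, hb, rfl⟩
  · exact Or.inl (mul_mem h hp)
  · exact Or.inr ⟨a, ha, b * p, mul_mem hb hp, by simp only [mul_assoc]⟩

lemma AA_y : AA fy := Or.inr ⟨1, one_mem _, 1, one_mem _, by simp⟩

lemma y_inv : fy⁻¹ = fx * fy * zz⁻¹ := by rw [zz]; group

lemma AA.inv {g : F} (h : AA g) : AA g⁻¹ := by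
  rcases h with h | ⟨a, ha, b, hb, rfl⟩
  · exact Or.inl (inv_mem h)
  · rw [_root_.mul_inv_rev, _root_.mul_inv_rev, y_inv]
    exact ((((AA_y.left x_PF).right (inv_mem z_PF)).right (inv_mem ha))).left (inv_mem hb)

lemma AA_one : AA 1 := Or.inl (one_mem _)

/-- the relation -/
def Nb (g g' : F) : Prop := AA (g⁻¹ * g')

lemma Nb.symm {g g' : F} (h : Nb g g') : Nb g' g := by
  have := AA.inv h
  rwa [_root_.mul_inv_rev, inv_inv] at this

lemma Nb.left {g g' h : F} (n : Nb g h) (hp : g⁻¹ * g' ∈ PF) : Nb g' h := by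
  have := AA.left (inv_mem hp) n
  rw [Nb]; convert this using 1; group

lemma Nb.right {g h h' : F} (n : Nb g h) (hp : h⁻¹ * h' ∈ PF) : Nb g h' := by
  have := AA.right hp n
  rw [Nb]; convert this using 1; group

lemma Nb.mul {g h : F} (k : F) (n : Nb g h) : Nb (k * g) (k * h) := by
  rw [Nb] at *; convert n using 1; group

lemma Nb_PF {g h : F} (n : g⁻¹ * h ∈ PF) : Nb g h := Or.inl n

lemma PF_nf {p : F} (hp : p ∈ PF) : ∃ (l b : ℤ) (f s : R2), Val f s ∧ ∀ w, lin p w = (T l : R2) • nn f s (DD b w) := by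
  obtain ⟨k, hk⟩ := PF_Stab hp
  exact stab_form p _ hk

lemma PF_eq {p q : F} (hp : p ∈ PF) (hq : q ∈ PF) (l : ℤ) (h : ∀ w, lin p w = (T l : R2) • lin q w) :
    ∃ m ∈ MM, p = m * q := by
  refine ⟨p * q⁻¹, PF_KK (mul_mem hp (inv_mem hq)) ⟨l, fun w => ?_⟩, by group⟩
  rw [lin_mul, h, lin_inv_r]

lemma lin_y_e1 : lin fy e1 = e3 := by
  rw [lin_y]; simp

lemma T_smul_cancel (k : ℤ) {v w : V} (h : (T k : R2) • v = (T k : R2) • w) : v = w := by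
  have := congrArg (fun v => (T (-k) : R2) • v) h
  simpa only [smul_smul, T_T, neg_add_cancel, T_zero, one_smul] using this

lemma nn_DD_e3 (f s : R2) (b : ℤ) : nn f s (DD b e3) = (T b : R2) • ((s, f, 1) : V) := by
  refine V_ext ?_ ?_ ?_ <;> simp [nn, DD, mul_comm]

lemma AA_Stab {g : F} (h : AA g) (hs : g ∈ StabL) : g ∈ PF := by
  rcases h with h | ⟨p, hp, q, hq, rfl⟩
  · exact h
  exfalso
  have : fy ∈ StabL := by
    have := mul_mem (mul_mem (inv_mem (PF_Stab hp)) hs) (inv_mem (PF_Stab hq))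
    convert this using 1; group
  obtain ⟨k, hk⟩ := this
  rw [lin_y_e1] at hk
  have := congrArg (fun v : V => v.2.2) hk
  simp at this

lemma ey : ee * fy = fy * (fx * zz) := by rw [ee, zz]; group

lemma ey_pow (b : ℤ) : ee ^ b * fy = fy * (fx * zz) ^ b := by
  have : ee = fy * (fx * zz) * fy⁻¹ := by rw [← ey]; group
  rw [this, conj_zpow]; group

lemma xz_PF (b : ℤ) : (fx * zz) ^ b ∈ PF := zpow_mem (mul_mem x_PF z_PF) _

lemma y_ee_y (b : ℤ) : fy⁻¹ * ee ^ b * fy ∈ PF := by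
  rw [mul_assoc, ey_pow, inv_mul_cancel_left]; exact xz_PF b

lemma MM_conj {m : F} (h : m ∈ MM) (g : F) : g⁻¹ * m * g ∈ MM := by
  have := Subgroup.Normal.conj_mem inferInstance m h g⁻¹
  simpa using this

lemma KK_conj {m : F} (h : m ∈ KK) (g : F) : g⁻¹ * m * g ∈ KK := by
  have := Subgroup.Normal.conj_mem inferInstance m h g⁻¹
  simpa using this

lemma MM_of_conj {m : F} (g : F) (h : g⁻¹ * m * g ∈ MM) : m ∈ MM := by
  have := MM_conj h g⁻¹
  convert this using 1; group

lemma fix_e3 {p : F} (hp : p ∈ PF) (c : R2) (h : lin p e3 = c • e3) : ∃ m ∈ MM, ∃ b : ℤ, p = m * ee ^ b := by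
  obtain ⟨l, b, f, s, hv, hn⟩ := PF_nf hp
  have h3 := hn e3
  rw [h, nn_DD_e3, smul_smul, T_T] at h3
  have hs : s = 0 := by
    have := congrArg (fun v : V => v.1) h3
    simp only [Prod.smul_fst, smul_eq_mul, mul_zero] at this
    exact (mul_eq_zero.1 this.symm).resolve_left (T_ne _)
  have hf : f = 0 := by
    have := congrArg (fun v : V => v.2.1) h3
    simp only [Prod.smul_snd, Prod.smul_fst, smul_eq_mul, mul_zero] at this
    exact (mul_eq_zero.1 this.symm).resolve_left (T_ne _)
  subst hs hf
  obtain ⟨m, hm, e⟩ := PF_eq hp (zpow_mem (HH_PF ee_HH) b) l (fun w => by rw [hn, nn_zero, lin_ee_zpow])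
  exact ⟨m, hm, b, e⟩

lemma Cp {a k : F} (ha : AA a) (hk : k ∈ KK) (hka : AA (k * a)) : k ∈ MM := by
  have case1 : ∀ a k : F, a ∈ PF → k ∈ KK → AA (k * a) → k ∈ MM := by
    intro a k ha hk hka
    have := AA_Stab hka (mul_mem (KK_Stab hk) (PF_Stab ha))
    have h2 := mul_mem this (inv_mem ha)
    rw [mul_inv_cancel_right] at h2
    exact PF_KK h2 hk
  rcases ha with ha | ⟨p, hp, q, hq, rfl⟩
  · exact case1 a k ha hk hka
  rcases hka with hka | ⟨p2, hp2, q2, hq2, e⟩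
  · have : k⁻¹ ∈ MM := case1 _ _ hka (inv_mem hk) (by
      rw [inv_mul_cancel_left]; exact Or.inr ⟨p, hp, q, hq, rfl⟩)
    simpa using this
  obtain ⟨k1, hk1⟩ : ∃ k1, k1 = p⁻¹ * k * p := ⟨_, rfl⟩
  have hk1K : k1 ∈ KK := hk1 ▸ KK_conj hk p
  obtain ⟨p', hp'⟩ : ∃ p', p' = p⁻¹ * p2 := ⟨_, rfl⟩
  obtain ⟨q', hq'⟩ : ∃ q', q' = q2 * q⁻¹ := ⟨_, rfl⟩
  have hpP : p' ∈ PF := hp' ▸ mul_mem (inv_mem hp) hp2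
  have hqP : q' ∈ PF := hq' ▸ mul_mem hq2 (inv_mem hq)
  have e2 : k1 * fy = p' * fy * q' := by
    have : p⁻¹ * (k * (p * fy * q)) * q⁻¹ = p⁻¹ * (p2 * fy * q2) * q⁻¹ := by rw [e]
    rw [hk1, hp', hq']
    convert this using 1 <;> group
  obtain ⟨kk, hkk⟩ := hk1K
  obtain ⟨d, hd⟩ := PF_Stab hqP
  have h3 : lin p' e3 = (T (kk - d) : R2) • e3 := by
    have h := congrArg (fun g => lin g e1) e2
    simp only [lin_mul, hd, hkk, lin_smul, lin_y_e1] at h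
    apply T_smul_cancel d
    rw [← h, smul_smul, T_T]; congr 2; ring
  obtain ⟨m, hm, b, hb⟩ := fix_e3 hpP _ h3
  have h4 : fy⁻¹ * k1 * fy ∈ PF := by
    have : fy⁻¹ * k1 * fy = (fy⁻¹ * m * fy) * ((fy⁻¹ * ee ^ b * fy) * q') := by
      rw [mul_assoc, e2, hb]; group
    rw [this]
    exact mul_mem (MM_PF (MM_conj hm _)) (mul_mem (y_ee_y b) hqP)
  have h5 := PF_KK h4 (KK_conj ⟨kk, hkk⟩ _)
  have h6 := MM_of_conj _ h5
  rw [hk1] at h6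
  exact MM_of_conj _ h6

def Core (g : F) (Λ : LV) : Prop := CC (lin g e1) Λ

lemma CC.scale {u : V} {Λ : LV} (h : CC u Λ) (l : ℤ) : CC ((T l : R2) • u) Λ := by
  obtain ⟨k, h1, h2⟩ := h
  refine ⟨k - l, ?_, fun w hw => ?_⟩
  · rw [smul_smul, T_T, sub_add_cancel]; exact h1
  · rw [hh_smul_right, cj_T]; exact (h2 w hw).Tmul _ (by omega)

lemma Core.mulP {g p : F} {Λ : LV} (h : Core g Λ) (hp : p ∈ PF) : Core (g * p) Λ := by
  obtain ⟨d, hd⟩ := PF_Stab hp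
  rw [Core, lin_mul, hd, lin_smul]; exact CC.scale h d

lemma Core.Kmul {g k : F} {Λ : LV} (h : Core g Λ) (hk : k ∈ KK) : Core (k * g) Λ := by
  obtain ⟨d, hd⟩ := hk
  rw [Core, lin_mul, hd]; exact CC.scale h d

lemma Core.PF {g g' : F} {Λ : LV} (h : Core g Λ) (hp : g⁻¹ * g' ∈ PF) : Core g' Λ := by
  have := h.mulP hp
  rwa [mul_inv_cancel_left] at this

lemma F2 {g g' : F} {Λ : LV} (h : Core g Λ) (h' : Core g' Λ) : ∃ k ∈ KK, ∃ p ∈ PF, g' = k * g * p := by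
  obtain ⟨k, h1, h2⟩ := h
  obtain ⟨l, h3, h4⟩ := h'
  have a1 := h4 _ h1
  have a2 := h2 _ h3
  rw [hh_smul_left] at a1 a2
  rw [hh_swap (lin g e1) (lin g' e1)] at a2
  have q0 : hh (lin g e1) (lin g' e1) = 0 := by
    refine Ge_both (M := l + 1 - k) (N := k - l) (a1.of_Tmul k (by omega)) ?_ (by omega)
    exact ((a2.of_Tmul (L := k + 1 - l) l (by omega)).of_Tmul 1 (by omega))
  have q1 : hh (lin g' e1) (lin g e1) = 0 := by rw [hh_swap (lin g e1) (lin g' e1), q0, cj_zero, mul_zero]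
  obtain ⟨a, b, c, hw⟩ : ∃ a b c, lin (g⁻¹ * g') e1 = (a, b, c) := ⟨_, _, _, rfl⟩
  have i1 := hh_inv g⁻¹ (lin g' e1) (lin g e1)
  rw [q1, lin_inv_l, ← lin_mul, hw, hh_e1] at i1
  have hc : c = 0 := (mul_eq_zero.1 i1).resolve_left (T_ne _)
  subst hc
  have i2 := hh_inv (g⁻¹ * g') e1 e1
  rw [hw] at i2
  simp only [hh, cj_zero, mul_zero, zero_mul, add_zero, zero_add] at i2
  have hb : b = 0 := by
    rcases mul_eq_zero.1 i2 with h | h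
    · exact (mul_eq_zero.1 h).resolve_left opt_ne
    · exact cj_zero_iff.1 h
  subst hb
  have hs : g⁻¹ * g' ∈ StabL := by
    obtain ⟨l, b, f, s, hv, hn⟩ := stab_form (g⁻¹ * g') a (by rw [hw]; simp)
    refine ⟨l + b, ?_⟩
    rw [hn, ← T_T, ← smul_smul]; congr 1; simp [nn, DD]
  obtain ⟨p, hp, hk⟩ := stab_PK hs
  refine ⟨(g * p)  * (p⁻¹ * (g⁻¹ * g')) * (g * p)⁻¹, Subgroup.Normal.conj_mem inferInstance _ hk _, p, HH_PF hp, ?_⟩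
  group

lemma uniq {g g' h : F} {Λ : LV} (c : Core g Λ) (c' : Core g' Λ) (n : Nb g h) (n' : Nb g' h) : g⁻¹ * g' ∈ PF := by
  obtain ⟨k, hk, p, hp, rfl⟩ := F2 c c'
  have n2 : AA ((g⁻¹ * k⁻¹ * g) * (g⁻¹ * h)) := by
    have := AA.left hp n'
    convert this using 1; group
  have := Cp n (KK_conj (inv_mem hk) g) n2
  have := inv_mem this
  have e : g⁻¹ * (k * g * p) = (g⁻¹ * k⁻¹ * g)⁻¹ * p := by group
  rw [e]
  exact mul_mem (MM_PF this) hp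

def Tr3 (Λ1 Λ2 Λ3 : LV) : Prop := ∃ a b c, Core a Λ1 ∧ Core b Λ2 ∧ Core c Λ3 ∧ Nb a b ∧ Nb b c ∧ Nb a c

lemma Tr3.swap {Λ1 Λ2 Λ3 : LV} (h : Tr3 Λ1 Λ2 Λ3) : Tr3 Λ2 Λ1 Λ3 := by
  obtain ⟨a, b, c, h1, h2, h3, h4, h5, h6⟩ := h
  exact ⟨b, a, c, h2, h1, h3, h4.symm, h6, h5⟩

lemma Tr3.swap' {Λ1 Λ2 Λ3 : LV} (h : Tr3 Λ1 Λ2 Λ3) : Tr3 Λ1 Λ3 Λ2 := by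
  obtain ⟨a, b, c, h1, h2, h3, h4, h5, h6⟩ := h
  exact ⟨a, c, b, h1, h3, h2, h6, h5.symm, h4⟩

lemma Tr3.close {Λ1 Λ2 Λ3 : LV} (h : Tr3 Λ1 Λ2 Λ3) {a' b' c' : F} (ca : Core a' Λ1) (cb : Core b' Λ2)
    (cc : Core c' Λ3) (nab : Nb a' b') (nbc : Nb b' c') : Nb a' c' := by
  obtain ⟨a, b, c, h1, h2, h3, h4, h5, h6⟩ := h
  obtain ⟨k, hk, p, hp, rfl⟩ := F2 h2 cb
  have e : (k * b)⁻¹ * (k * b * p) ∈ PF := by rw [inv_mul_cancel_left]; exact hp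
  have u1 := uniq (h1.Kmul hk) ca ((h4.mul k).right e) nab
  have u2 := uniq (h3.Kmul hk) cc ((h5.symm.mul k).right e) nbc.symm
  exact ((h6.mul k).left u1).right u2

def pull (g : F) (Λ : LV) : LV := Λ.comap ((lin g).toLinearMap.toAddMonoidHom)

lemma mem_pull {g : F} {Λ : LV} {w : V} : w ∈ pull g Λ ↔ lin g w ∈ Λ := Iff.rfl

lemma lin_GeV (g : F) : ∃ N : ℤ, ∀ K w, GeV K w → GeV (K + N) (lin g w) := by
  obtain ⟨a, ha⟩ := ex_GeV (lin g e1)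
  obtain ⟨b, hb⟩ := ex_GeV (lin g e2)
  obtain ⟨c, hc⟩ := ex_GeV (lin g e3)
  refine ⟨min a (min b c), fun K w hw => ?_⟩
  rw [lin_decomp]
  exact ((ha.smul hw.1 (by omega)).add (hb.smul hw.2.1 (by omega))).add (hc.smul hw.2.2 (by omega))

lemma IsLat.pull {Λ : LV} (h : IsLat Λ) (g : F) : IsLat (pull g Λ) := by
  obtain ⟨ht, K, h1, h2⟩ := h
  refine ⟨fun w hw => ?_, ?_⟩
  · rw [mem_pull, lin_smul]; exact ht _ hw
  · obtain ⟨M, hM⟩ := lin_GeV g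
    obtain ⟨N, hN⟩ := lin_GeV g⁻¹
    refine ⟨max (K - M) (K - N), fun w hw => h1 _ ((hM _ _ hw).mono (by omega)), fun w hw => ?_⟩
    have := hN _ _ (h2 (lin g w) hw)
    rw [lin_inv_l] at this
    exact this.mono (by omega)

lemma CC_pull {g : F} {Λ : LV} {u : V} : CC u (pull g Λ) ↔ CC (lin g u) Λ := by
  constructor
  · rintro ⟨k, h1, h2⟩
    refine ⟨k, by rwa [mem_pull, lin_smul] at h1, fun w hw => ?_⟩
    have := h2 (lin g⁻¹ w) (by rw [mem_pull, lin_inv_r]; exact hw)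
    rwa [← hh_inv g, lin_inv_r] at this
  · rintro ⟨k, h1, h2⟩
    refine ⟨k, by rwa [mem_pull, lin_smul], fun w hw => ?_⟩
    rw [← hh_inv g]; exact h2 _ hw

lemma Core_pull {g h : F} {Λ : LV} : Core h (pull g Λ) ↔ Core (g * h) Λ := by
  rw [Core, CC_pull, Core, lin_mul]

lemma Core_e1 {Λ : LV} : Core 1 Λ ↔ CC e1 Λ := by rw [Core, lin_one]

lemma nn_e3 (f s : R2) : nn f s e3 = (s, f, 1) := by
  simp [nn]

lemma F1e {Λ : LV} (hL : IsLat Λ) (k : ℤ) (h1 : (T (k + 1) : R2) • e1 ∈ Λ)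
    (h2 : ∀ w ∈ Λ, Ge k w.2.2) : Core 1 Λ ∨ ∃ p ∈ PF, Core (p * fy) Λ := by
  rcases lemD hL k h1 h2 with h | ⟨f, s, hv, h⟩
  · exact Or.inl (Core_e1.2 h)
  · obtain ⟨p, hp, hpn⟩ := Re.of_val hv
    refine Or.inr ⟨p, HH_PF hp, ?_⟩
    rw [Core, lin_mul, lin_y_e1, hpn, nn_e3]; exact h

/-- `Λ2 ⊂ Λ1`, `t Λ1 ⊂ Λ2` -/
def Adj (Λ1 Λ2 : LV) : Prop := Λ2 ≤ Λ1 ∧ ∀ w ∈ Λ1, (T 1 : R2) • w ∈ Λ2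

lemma CC_e1 {Λ : LV} (h : CC e1 Λ) : ∃ k : ℤ, (T k : R2) • e1 ∈ Λ ∧ ∀ w ∈ Λ, Ge k w.2.2 := by
  obtain ⟨k, h1, h2⟩ := h
  refine ⟨k, h1, fun w hw => ?_⟩
  have := h2 w hw
  rw [hh_e1] at this
  exact this.of_Tmul 1 le_rfl

lemma Adj.pull {Λ1 Λ2 : LV} (h : Adj Λ1 Λ2) (g : F) : Adj (pull g Λ1) (pull g Λ2) :=
  ⟨fun w hw => h.1 hw, fun w hw => by rw [mem_pull, lin_smul]; exact h.2 _ hw⟩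

lemma F1 {g : F} {Λ1 Λ2 : LV} (c : Core g Λ1) (hL : IsLat Λ2) (ha : Adj Λ1 Λ2) :
    Core g Λ2 ∨ ∃ p ∈ PF, Core (g * p * fy) Λ2 := by
  have c' : Core 1 (pull g Λ1) := by rw [Core_pull, mul_one]; exact c
  obtain ⟨k, h1, h2⟩ := CC_e1 (Core_e1.1 c')
  have ha' := ha.pull g
  have := F1e (hL.pull g) k (by
    have := ha'.2 _ h1
    rwa [smul_smul, T_T, add_comm] at this) (fun w hw => h2 w (ha'.1 hw))
  simpa only [Core_pull, mul_one, mul_assoc] using this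

lemma yxy : AA (fy⁻¹ * fx * fy) := by
  have e : fy⁻¹ * fx * fy = (fy ^ 3)⁻¹ * fy * zz := by rw [zz]; group
  rw [e]
  exact Or.inr ⟨_, MM_PF (inv_mem y3_MM), _, z_PF, rfl⟩

lemma lin_exe (j : ℤ) (w : V) : lin (ee ^ (-j) * fx * ee ^ j) w = nn (T j) (T 1) w := by
  rw [lin_mul, lin_mul, lin_x', lin_ee_zpow, lin_ee_zpow, DD_nn, DD_DD, neg_add_cancel, DD_zero, mul_one]

lemma F3a {n : F} (hn : n ∈ PF) {L1 L2 L3 : LV} (c1 : CC e1 L1) (c2 : CC e3 L2) (c3 : CC (lin n e3) L3)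
    (h12 : L2 ≤ L1) (h23 : L3 ≤ L2) (h31 : ∀ w ∈ L1, (T 1 : R2) • w ∈ L3) : AA (fy⁻¹ * n * fy) := by
  obtain ⟨l, b, f, s, hv, hnf⟩ := PF_nf hn
  have c3' : CC ((s, f, 1) : V) L3 := by
    have := c3.scale (-(l + b))
    rw [hnf, nn_DD_e3, smul_smul, smul_smul, T_T, T_T] at this
    have e : -(l + b) + l + b = 0 := by ring
    rwa [e, T_zero, one_smul] at this
  obtain ⟨k, a1, a2⟩ := CC_e1 c1
  obtain ⟨k2, b1, b2⟩ := c2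
  obtain ⟨k3, d1, d2⟩ := c3'
  have a3 : (T (k + 1) : R2) • e1 ∈ L3 := by
    have := h31 _ a1
    rwa [smul_smul, T_T, add_comm] at this
  have w2 := a2 _ (h12 b1)
  have w3 := b2 _ (h23 a3)
  have w4 := a2 _ (h12 (h23 d1))
  have w5 := d2 _ a3
  have he3 : ∀ w, hh w e3 = w.1 := fun w => by simp [hh]
  rw [he3] at w3
  rw [hh_u] at w5
  simp only [Prod.smul_fst, Prod.smul_snd, smul_eq_mul, mul_one, mul_zero, zero_mul, add_zero, Ge_T] at w2 w3 w4 w5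
  obtain rfl : k2 = k := by omega
  obtain rfl : k3 = k2 := by omega
  have s1 := b2 _ (h23 d1)
  rw [he3] at s1
  have s1 : Ge 1 s := Ge.of_Tmul k3 s1 (by omega)
  have s2 := d2 _ (h31 _ (h12 b1))
  rw [hh_smul_left, hh_smul_left, hh_u] at s2
  simp only [mul_zero, zero_mul, add_zero, zero_add, mul_one] at s2
  have s2 : Ge (-1) (cj s) := ((s2.of_Tmul (L := k3) 1 (by omega)).of_Tmul (L := 0) k3 (by omega)).of_Tmul 1 (by omega)
  rcases Ge_succ s1 with h | h
  · have hs : s = 0 := Ge_both h s2 (by omega)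
    have hf : f = 0 := by
      rw [Val, hs, cj_zero, mul_zero, add_zero] at hv
      rcases mul_eq_zero.1 hv.symm with h | h
      · exact (mul_eq_zero.1 h).resolve_left opt_ne
      · exact cj_zero_iff.1 h
    subst hs hf
    obtain ⟨m, hm, e⟩ := PF_eq hn (zpow_mem (HH_PF ee_HH) b) l (fun w => by rw [hnf, nn_zero, lin_ee_zpow])
    left
    have : fy⁻¹ * n * fy = (fy⁻¹ * m * fy) * (fy⁻¹ * ee ^ b * fy) := by rw [e]; group
    rw [this]
    exact mul_mem (MM_PF (MM_conj hm _)) (y_ee_y b)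
  · have hs : s = T 1 := by
      refine eq_of_add (Ge_both h (N := -1) ?_ (by omega))
      rw [cj_add, cj_T]; exact s2.add (Ge.of_T le_rfl)
    have hf : f * cj f = 1 := by
      rw [Val, hs, cj_T, tt1] at hv
      refine mul_left_cancel₀ opt_ne ?_
      rw [← mul_assoc, ← hv, mul_one, add_comm]
    obtain ⟨j, rfl⟩ := unit_T' hf
    subst hs
    have hq : ee ^ (-j) * fx * ee ^ j * ee ^ b ∈ PF :=
      mul_mem (mul_mem (mul_mem (zpow_mem (HH_PF ee_HH) _) x_PF) (zpow_mem (HH_PF ee_HH) _)) (zpow_mem (HH_PF ee_HH) _)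
    obtain ⟨m, hm, e⟩ := PF_eq hn hq l (fun w => by rw [hnf, lin_mul, lin_exe, lin_ee_zpow])
    have : fy⁻¹ * n * fy = (fy⁻¹ * m * fy) * ((fy⁻¹ * ee ^ (-j) * fy) * ((fy⁻¹ * fx * fy) *
        ((fy⁻¹ * ee ^ j * fy) * (fy⁻¹ * ee ^ b * fy)))) := by rw [e]; group
    rw [this]
    exact ((yxy.right (mul_mem (y_ee_y _) (y_ee_y _))).left (y_ee_y _)).left (MM_PF (MM_conj hm _))

lemma F3 {g : F} {Λ1 Λ2 Λ3 : LV} (c : Core g Λ1) (hL2 : IsLat Λ2) (hL3 : IsLat Λ3)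
    (h12 : Λ2 ≤ Λ1) (h23 : Λ3 ≤ Λ2) (h31 : ∀ w ∈ Λ1, (T 1 : R2) • w ∈ Λ3) : Tr3 Λ1 Λ2 Λ3 := by
  have ny : ∀ p ∈ PF, Nb g (g * p * fy) := fun p hp => by
    rw [Nb, mul_assoc, inv_mul_cancel_left]; exact AA_y.left hp
  have n1 : ∀ g, Nb g g := fun g => by rw [Nb, inv_mul_cancel]; exact AA_one
  rcases F1 c hL2 ⟨h12, fun w hw => h23 (h31 w hw)⟩ with h | ⟨p2, hp2, h⟩ <;>
  rcases F1 c hL3 ⟨h23.trans h12, h31⟩ with h' | ⟨p3, hp3, h'⟩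
  · exact ⟨g, g, g, c, h, h', n1 g, n1 g, n1 g⟩
  · exact ⟨g, g, _, c, h, h', n1 g, ny p3 hp3, ny p3 hp3⟩
  · exact ⟨g, _, g, c, h, h', ny p2 hp2, (ny p2 hp2).symm, n1 g⟩
  · refine ⟨g, _, _, c, h, h', ny p2 hp2, ?_, ny p3 hp3⟩
    have := F3a (n := p2⁻¹ * p3) (mul_mem (inv_mem hp2) hp3)
      (L1 := pull (g * p2) Λ1) (L2 := pull (g * p2) Λ2) (L3 := pull (g * p2) Λ3)
      (Core_e1.1 (by rw [Core_pull, mul_one]; exact c.mulP hp2))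
      (by rw [← lin_y_e1]; change Core _ _; rw [Core_pull]; exact h)
      (by rw [← lin_y_e1, ← lin_mul]; change Core _ _; rw [Core_pull]; convert h' using 1; group)
      (fun w hw => h12 hw) (fun w hw => h23 hw) (fun w hw => by rw [mem_pull, lin_smul]; exact h31 _ hw)
    rw [Nb]; convert this using 1; group

def LL (k : ℤ) : LV where
  carrier := {w | GeV k w}
  zero_mem' := ⟨Ge.zero _, Ge.zero _, Ge.zero _⟩
  add_mem' := fun h h' => h.add h'
  neg_mem' := by
    intro w h
    have : -w = w := by refine V_ext ?_ ?_ ?_ <;> simp [CharTwo.neg_eq]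
    rw [this]; exact h

lemma mem_LL {k : ℤ} {w : V} : w ∈ LL k ↔ GeV k w := Iff.rfl

lemma LL_mono {k l : ℤ} (h : k ≤ l) : LL l ≤ LL k := fun w hw => GeV.mono hw h

lemma GeV.T {k : ℤ} {w : V} (h : GeV k w) (l : ℤ) {N : ℤ} (hN : N ≤ l + k) : GeV N ((T l : R2) • w) :=
  h.smul (Ge.of_T (N := l) le_rfl) hN

lemma LL_lat (k : ℤ) : IsLat (LL k) :=
  ⟨fun w hw => GeV.T hw 1 (by omega), max k (-k), fun w hw => hw.mono (by omega), fun w hw => GeV.mono hw (by omega)⟩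

lemma LL_core (k : ℤ) : Core 1 (LL k) := by
  rw [Core_e1]
  refine ⟨k, ?_, fun w hw => ?_⟩
  · refine ⟨?_, ?_, ?_⟩
    · simpa using Ge.of_T (le_refl k)
    · simpa using Ge.zero k
    · simpa using Ge.zero k
  · rw [hh_e1]; exact hw.2.2.Tmul _ (by omega)

def IR (k : ℕ) (Λ : LV) : Prop := TC Λ ∧ LL k ≤ Λ ∧ Λ ≤ LL 0

lemma IR.lat {k : ℕ} {Λ : LV} (h : IR k Λ) : IsLat Λ :=
  ⟨h.1, k, fun w hw => h.2.1 hw, fun w hw => GeV.mono (h.2.2 hw) (by omega)⟩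

noncomputable def SS : ℕ → LV → F
  | 0, _ => 1
  | k + 1, Λ => Classical.epsilon (fun g => Core g Λ ∧ Nb (SS k (Λ ⊔ LL k)) g)

lemma IR.sup {k : ℕ} {Λ : LV} (h : IR (k + 1) Λ) : IR k (Λ ⊔ LL k) := by
  refine ⟨fun w hw => ?_, le_sup_right, sup_le h.2.2 (LL_mono (by omega))⟩
  obtain ⟨a, ha, b, hb, rfl⟩ := AddSubgroup.mem_sup.1 hw
  rw [smul_add]
  exact add_mem (AddSubgroup.mem_sup_left (h.1 _ ha)) (AddSubgroup.mem_sup_right ((LL_lat k).1 _ hb))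

lemma t_sup {k : ℕ} {Λ Λ' : LV} (h' : LL ((k + 1 : ℕ) : ℤ) ≤ Λ') (h : ∀ w ∈ Λ, (T 1 : R2) • w ∈ Λ') :
    ∀ w ∈ Λ ⊔ LL k, (T 1 : R2) • w ∈ Λ' := by
  intro w hw
  obtain ⟨a, ha, b, hb, rfl⟩ := AddSubgroup.mem_sup.1 hw
  rw [smul_add]
  exact add_mem (h _ ha) (h' (GeV.T hb 1 (by push_cast; omega)))

lemma IR0 {Λ : LV} (h : IR 0 Λ) : Λ = LL 0 := le_antisymm h.2.2 (by simpa using h.2.1)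

lemma Nb_refl (g : F) : Nb g g := by rw [Nb, inv_mul_cancel]; exact AA_one

lemma F1' {g : F} {Λ1 Λ2 : LV} (c : Core g Λ1) (hL : IsLat Λ2) (ha : Adj Λ1 Λ2) : ∃ g', Core g' Λ2 ∧ Nb g g' := by
  rcases F1 c hL ha with h | ⟨p, hp, h⟩
  · exact ⟨g, h, Nb_refl g⟩
  · exact ⟨_, h, by rw [Nb, mul_assoc, inv_mul_cancel_left]; exact AA_y.left hp⟩

lemma SS_spec {k : ℕ} (ih : ∀ Λ, IR k Λ → Core (SS k Λ) Λ) {Λ : LV} (h : IR (k + 1) Λ) :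
    Core (SS (k + 1) Λ) Λ ∧ Nb (SS k (Λ ⊔ LL k)) (SS (k + 1) Λ) := by
  have := F1' (ih _ h.sup) h.lat ⟨le_sup_left, t_sup h.2.1 h.1⟩
  exact Classical.epsilon_spec (p := fun g => Core g Λ ∧ Nb (SS k (Λ ⊔ LL k)) g) this

lemma IC (k : ℕ) : (∀ Λ, IR k Λ → Core (SS k Λ) Λ) ∧
    (∀ Λ1 Λ2, IR k Λ1 → IR k Λ2 → Adj Λ1 Λ2 → Nb (SS k Λ1) (SS k Λ2)) := by
  induction k with
  | zero =>
    refine ⟨fun Λ h => ?_, fun _ _ _ _ _ => ?_⟩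
    · rw [IR0 h]; exact LL_core 0
    · exact Nb_refl _
  | succ k ih =>
    obtain ⟨ih1, ih2⟩ := ih
    refine ⟨fun Λ h => (SS_spec ih1 h).1, fun Λ1 Λ2 h1 h2 ha => ?_⟩
    obtain ⟨c1, n1⟩ := SS_spec ih1 h1
    obtain ⟨c2, n2⟩ := SS_spec ih1 h2
    have r1 := ih1 _ h1.sup
    have r2 := ih1 _ h2.sup
    have l12 : Λ2 ⊔ LL k ≤ Λ1 ⊔ LL k := sup_le_sup_right ha.1 _
    have tt := t_sup h2.2.1 ha.2
    have n12 := ih2 _ _ h1.sup h2.sup ⟨l12, fun w hw => AddSubgroup.mem_sup_left (tt w hw)⟩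
    have T1 : Tr3 (Λ1 ⊔ LL k) (Λ2 ⊔ LL k) Λ2 := F3 r1 h2.sup.lat h2.lat l12 le_sup_left tt
    have T2 : Tr3 (Λ1 ⊔ LL k) Λ1 Λ2 := F3 r1 h1.lat h2.lat le_sup_left ha.1 tt
    have m := T1.close r1 r2 c2 n12 n2
    exact T2.swap.close c1 r1 c2 n1.symm m

def sc (a : ℤ) (Λ : LV) : LV := Λ.comap (DistribSMul.toAddMonoidHom V (T (-a) : R2))

lemma mem_sc {a : ℤ} {Λ : LV} {w : V} : w ∈ sc a Λ ↔ (T (-a) : R2) • w ∈ Λ := Iff.rfl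

lemma TT_smul (a b : ℤ) (w : V) : (T a : R2) • (T b : R2) • w = (T (a + b) : R2) • w := by
  rw [smul_smul, T_T]

lemma Core.sc {g : F} {Λ : LV} (h : Core g Λ) (a : ℤ) : Core g (sc a Λ) := by
  obtain ⟨k, h1, h2⟩ := h
  refine ⟨k + a, ?_, fun w hw => ?_⟩
  · rw [mem_sc, TT_smul]; convert h1 using 3; ring
  · have := h2 _ (mem_sc.1 hw)
    rw [hh_smul_left] at this
    exact this.of_Tmul _ (by omega)

lemma Adj.sc {Λ1 Λ2 : LV} (h : Adj Λ1 Λ2) (a : ℤ) : Adj (sc a Λ1) (sc a Λ2) :=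
  ⟨fun w hw => h.1 hw, fun w hw => by
    rw [mem_sc, TT_smul, add_comm, ← TT_smul]; exact h.2 _ hw⟩

lemma IsLat.IR {Λ : LV} (h : IsLat Λ) : ∃ a0 : ℤ, ∀ a ≥ a0, ∃ k0 : ℕ, ∀ k ≥ k0, IR k (sc a Λ) := by
  obtain ⟨ht, K, h1, h2⟩ := h
  refine ⟨K, fun a ha => ⟨(K + a).toNat, fun k hk => ⟨fun w hw => ?_, fun w hw => ?_, fun w hw => ?_⟩⟩⟩
  · rw [mem_sc, TT_smul, add_comm, ← TT_smul]; exact ht _ hw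
  · exact h1 _ (GeV.T hw (-a) (by omega))
  · have := (h2 _ (mem_sc.1 hw)).T a (N := 0) (by omega)
    rwa [TT_smul, add_neg_cancel, T_zero, one_smul] at this

def Good (g : F) (Λ : LV) : Prop := ∃ a0 : ℤ, ∀ a ≥ a0, ∃ k0 : ℕ, ∀ k ≥ k0, g⁻¹ * SS k (sc a Λ) ∈ PF

lemma Good.prop {g g' : F} {Λ Λ' : LV} (h : Good g Λ) (hL : IsLat Λ) (hL' : IsLat Λ')
    (c' : Core g' Λ') (n : Nb g g') (ha : Adj Λ Λ' ∨ Adj Λ' Λ) : Good g' Λ' := by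
  obtain ⟨a0, h⟩ := h
  obtain ⟨a1, h1⟩ := hL.IR
  obtain ⟨a2, h2⟩ := hL'.IR
  refine ⟨max a0 (max a1 a2), fun a hm => ?_⟩
  obtain ⟨k0, h⟩ := h a (by omega)
  obtain ⟨k1, h1⟩ := h1 a (by omega)
  obtain ⟨k2, h2⟩ := h2 a (by omega)
  refine ⟨max k0 (max k1 k2), fun k hk => ?_⟩
  have h := h k (by omega)
  have h1 := h1 k (by omega)
  have h2 := h2 k (by omega)
  have c2 := (IC k).1 _ h2
  have n2 : Nb (SS k (sc a Λ)) (SS k (sc a Λ')) := by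
    rcases ha with ha | ha
    · exact (IC k).2 _ _ h1 h2 (ha.sc a)
    · exact ((IC k).2 _ _ h2 h1 (ha.sc a)).symm
  have h' : (SS k (sc a Λ))⁻¹ * g ∈ PF := by
    have := inv_mem h
    rwa [_root_.mul_inv_rev, inv_inv] at this
  exact uniq (c'.sc a) c2 n.symm (n2.left h').symm

lemma LL_Adj (a : ℤ) : Adj (LL a) (LL (a + 1)) := ⟨LL_mono (by omega), fun w hw => GeV.T hw 1 (by omega)⟩

lemma LL_IR {a k : ℕ} (h : a ≤ k) : IR k (LL a) := ⟨(LL_lat _).1, LL_mono (by omega), LL_mono (by omega)⟩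

lemma SS_LL0 (k : ℕ) : SS k (LL 0) ∈ PF := by
  induction k with
  | zero => exact one_mem _
  | succ k ih =>
    have h := LL_IR (a := 0) (k := k + 1) (by omega)
    have hk := LL_IR (a := 0) (k := k) (by omega)
    rw [Nat.cast_zero] at h hk
    obtain ⟨c, n⟩ := SS_spec (IC k).1 h
    have e : LL 0 ⊔ LL k = LL 0 := sup_eq_left.2 (LL_mono (by omega))
    rw [e] at n
    have := uniq ((IC k).1 _ hk) c (Nb_refl _) n.symm
    have := mul_mem ih this
    rwa [mul_inv_cancel_left] at this

lemma SS_LL (a : ℕ) : ∀ k ≥ a, SS k (LL a) ∈ PF := by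
  induction a with
  | zero => intro k _; simpa using SS_LL0 k
  | succ a ih =>
    intro k hk
    have h1 := ih k (by omega)
    have n := (IC k).2 _ _ (LL_IR (a := a) (by omega)) (LL_IR (a := a + 1) hk) (by push_cast; exact LL_Adj a)
    have := uniq (LL_core _) ((IC k).1 _ (LL_IR (a := a + 1) hk)) (Nb_refl _) (n.left (by simpa using h1)).symm
    simpa using this

lemma sc_LL (a b : ℤ) : sc a (LL b) = LL (a + b) := by
  ext w
  rw [mem_sc, mem_LL, mem_LL]
  constructor
  · intro h
    have := h.T a (N := a + b) (by omega)
    rwa [TT_smul, add_neg_cancel, T_zero, one_smul] at this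
  · intro h; exact h.T _ (by omega)

lemma Good_one : Good 1 (LL 0) := by
  refine ⟨0, fun a ha => ⟨a.toNat, fun k hk => ?_⟩⟩
  rw [sc_LL, add_zero, inv_one, one_mul]
  have := SS_LL a.toNat k hk
  rwa [Int.toNat_of_nonneg ha] at this

def Lg (g : F) : LV := pull g⁻¹ (LL 0)

lemma mem_Lg {g : F} {w : V} : w ∈ Lg g ↔ GeV 0 (lin g⁻¹ w) := Iff.rfl

lemma Lg_core (g : F) : Core g (Lg g) := by
  rw [Lg, Core_pull, inv_mul_cancel]; exact LL_core 0

lemma Lg_lat (g : F) : IsLat (Lg g) := (LL_lat 0).pull _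

lemma step {s : F} (h1 : ∀ w, GeV 0 w → GeV 0 (lin s w)) (h2 : ∀ w, GeV 0 w → GeV 0 (lin s⁻¹ ((T 1 : R2) • w)))
    (hA : AA s) (g : F) : Good g (Lg g) ↔ Good (g * s) (Lg (g * s)) := by
  have ha : Adj (Lg g) (Lg (g * s)) := by
    refine ⟨fun w hw => ?_, fun w hw => ?_⟩
    · rw [mem_Lg, _root_.mul_inv_rev, lin_mul] at hw
      have := h1 _ hw
      rw [lin_inv_r] at this
      exact this
    · rw [mem_Lg, _root_.mul_inv_rev, lin_mul, lin_smul]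
      exact h2 _ hw
  have n : Nb g (g * s) := by rw [Nb, inv_mul_cancel_left]; exact hA
  exact ⟨fun h => h.prop (Lg_lat _) (Lg_lat _) (Lg_core _) n (Or.inl ha),
    fun h => h.prop (Lg_lat _) (Lg_lat _) (Lg_core _) n.symm (Or.inr ha)⟩

lemma inv_of {g : F} {v w : V} (h : lin g v = w) : lin g⁻¹ w = v := by rw [← h, lin_inv_l]

lemma lin_x_inv (w : V) : lin fx⁻¹ w = (w.1 + (1 + T 1) * w.2.1 + w.2.2, w.2.1 + w.2.2, w.2.2) := by
  apply inv_of
  rw [lin_x]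
  refine V_ext ?_ ?_ ?_ <;> dsimp only <;> grind

lemma lin_y_inv (w : V) : lin fy⁻¹ w = (w.1 + (1 + T 1) * w.2.1 + w.2.2, w.2.1 + T (-1) * w.1, T (-1) * w.1) := by
  apply inv_of
  rw [lin_y]
  have := tt1
  refine V_ext ?_ ?_ ?_ <;> dsimp only <;> grind

lemma Good_all (g : F) : ∀ h, Good h (Lg h) ↔ Good (h * g) (Lg (h * g)) := by
  have G1 : ∀ p : R2, Ge 0 p → Ge 0 (T 1 * p) := fun p hp => hp.Tmul _ (by omega)
  have G2 : ∀ p : R2, Ge 0 p → Ge 0 ((1 + T 1) * p) := fun p hp => Ge_opt.mul' hp (by omega)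
  refine F_ind (C := fun g => ∀ h, Good h (Lg h) ↔ Good (h * g) (Lg (h * g))) ?_ ?_ ?_ ?_ ?_ g
  · intro h; rw [mul_one]
  · refine step ?_ ?_ (Or.inl x_PF)
    · rintro w ⟨a, b, c⟩
      rw [lin_x]
      exact ⟨(a.add (G2 _ b)).add (G1 _ c), b.add c, c⟩
    · rintro w ⟨a, b, c⟩
      rw [lin_x_inv]
      exact ⟨((G1 _ a).add (G2 _ (G1 _ b))).add (G1 _ c), (G1 _ b).add (G1 _ c), (G1 _ c)⟩
  · refine step ?_ ?_ AA_y
    · rintro w ⟨a, b, c⟩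
      rw [lin_y]
      exact ⟨G1 _ c, b.add c, (a.add (G2 _ b)).add c⟩
    · rintro w ⟨a, b, c⟩
      rw [lin_y_inv]
      have e : T (-1) * ((T 1 : R2) • w).1 = w.1 := by
        rw [Prod.smul_fst, smul_eq_mul, ← mul_assoc, mul_comm (T (-1) : R2), tt1, one_mul]
      rw [e]
      exact ⟨((G1 _ a).add (G2 _ (G1 _ b))).add (G1 _ c), (G1 _ b).add a, a⟩
  · intro g ih h
    have := ih (h * g⁻¹)
    rw [inv_mul_cancel_right] at this
    exact this.symm
  · intro g g' ig ig' h
    rw [ig h, ig' (h * g), mul_assoc]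

theorem KK_le : KK ≤ MM := by
  intro k hk
  have h : Good k (Lg k) := by
    have := (Good_all k 1)
    rw [one_mul] at this
    refine this.1 ?_
    have e : Lg 1 = LL 0 := by ext w; rw [mem_Lg, inv_one, lin_one]; rfl
    rw [e]; exact Good_one
  obtain ⟨b, hb⟩ := inv_mem hk
  have e : ∀ a, sc a (Lg k) = sc (a - b) (LL 0) := by
    intro a; ext w
    rw [mem_sc, mem_sc, mem_Lg, hb, TT_smul, mem_LL]
    have : b + -a = -(a - b) := by ring
    rw [this]
  obtain ⟨a0, h⟩ := h
  obtain ⟨a1, h1⟩ := Good_one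
  obtain ⟨k0, h⟩ := h (max a0 (a1 + b)) (by omega)
  obtain ⟨k1, h1⟩ := h1 (max a0 (a1 + b) - b) (by omega)
  have h := h (max k0 k1) (by omega)
  have h1 := h1 (max k0 k1) (by omega)
  rw [e] at h
  rw [inv_one, one_mul] at h1
  have := mul_mem h1 (inv_mem h)
  rw [_root_.mul_inv_rev, inv_inv, mul_inv_cancel_left] at this
  exact PF_KK this hk

theorem KK_eq : KK = MM := le_antisymm KK_le MM_KK

def io (w : V) : Fin 3 → R2 := ![w.1 + T 1 * w.2.1 + w.2.2, (1 + T 1) * (w.2.1 + w.2.2), w.1 + w.2.1 + w.2.2]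

def ka (v : Fin 3 → R2) : V := ((1 + T 1) * (1 + T 1) * v 2 + (1 + T 1) * v 1, (1 + T 1) * (v 0 + v 2),
  (1 + T 1) * (v 0 + v 1 + v 2))

lemma v3 {v w : Fin 3 → R2} (h0 : v 0 = w 0) (h1 : v 1 = w 1) (h2 : v 2 = w 2) : v = w := by
  funext i; fin_cases i
  · exact h0
  · exact h1
  · exact h2

lemma io0 (w : V) : io w 0 = w.1 + T 1 * w.2.1 + w.2.2 := rfl
lemma io1 (w : V) : io w 1 = (1 + T 1) * (w.2.1 + w.2.2) := rfl
lemma io2 (w : V) : io w 2 = w.1 + w.2.1 + w.2.2 := rfl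

lemma io_ka (v : Fin 3 → R2) : io (ka v) = ((1 + T 1) * (1 + T 1) : R2) • v := by
  refine v3 ?_ ?_ ?_
  · rw [io0, ka]; simp only [Pi.smul_apply, smul_eq_mul]; grind
  · rw [io1, ka]; simp only [Pi.smul_apply, smul_eq_mul]; grind
  · rw [io2, ka]; simp only [Pi.smul_apply, smul_eq_mul]; grind

lemma io_smul (c : R2) (w : V) : io (c • w) = c • io w := by
  refine v3 ?_ ?_ ?_
  · simp only [Pi.smul_apply, smul_eq_mul, io0, Prod.smul_fst, Prod.smul_snd]; ring
  · simp only [Pi.smul_apply, smul_eq_mul, io1, Prod.smul_fst, Prod.smul_snd]; ring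
  · simp only [Pi.smul_apply, smul_eq_mul, io2, Prod.smul_fst, Prod.smul_snd]; ring

lemma io_inj {v w : V} (h : io v = io w) : v = w := by
  have h0 := congrFun h 0
  have h1 := congrFun h 1
  have h2 := congrFun h 2
  rw [io0, io0] at h0
  rw [io1, io1] at h1
  rw [io2, io2] at h2
  have b : v.2.1 = w.2.1 := mul_left_cancel₀ opt_ne (by grind)
  have bc := mul_left_cancel₀ opt_ne h1
  have c : v.2.2 = w.2.2 := by rw [b] at bc; exact add_left_cancel bc
  refine V_ext ?_ b c
  rw [b, c] at h2
  exact add_right_cancel (add_right_cancel h2)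

def Gm : F →* GL (Fin 3) R2 := FreeGroup.lift ![X, Y]

lemma Gm_x : (Gm fx : Matrix (Fin 3) (Fin 3) R2) = Xmat := by
  rw [Gm, fx, FreeGroup.lift_apply_of]; rfl
lemma Gm_y : (Gm fy : Matrix (Fin 3) (Fin 3) R2) = Ymat := by
  rw [Gm, fy, FreeGroup.lift_apply_of]; rfl

lemma inter (g : F) : ∃ k : ℤ, ∀ w, (Gm g : Matrix (Fin 3) (Fin 3) R2) *ᵥ io w = (T k : R2) • io (lin g w) := by
  refine F_ind (C := fun g => ∃ k : ℤ, ∀ w, (Gm g : Matrix (Fin 3) (Fin 3) R2) *ᵥ io w = (T k : R2) • io (lin g w))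
    ?_ ?_ ?_ ?_ ?_ g
  · refine ⟨0, fun w => ?_⟩
    rw [map_one, lin_one, T_zero, one_smul, Units.val_one, one_mulVec]
  · refine ⟨1, fun w => ?_⟩
    rw [Gm_x, Xmat, smul_mulVec, lin_x]
    congr 1
    refine v3 ?_ ?_ ?_
    · simp [Matrix.mulVec, dotProduct, Fin.sum_univ_three, io0, io1, io2]; grind
    · simp [Matrix.mulVec, dotProduct, Fin.sum_univ_three, io0, io1, io2]; grind
    · simp [Matrix.mulVec, dotProduct, Fin.sum_univ_three, io0, io1, io2]; grind
  · refine ⟨1, fun w => ?_⟩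
    rw [Gm_y, Ymat, smul_mulVec, lin_y]
    congr 1
    refine v3 ?_ ?_ ?_
    · simp [Matrix.mulVec, dotProduct, Fin.sum_univ_three, io0, io1, io2]; grind
    · simp [Matrix.mulVec, dotProduct, Fin.sum_univ_three, io0, io1, io2]; grind
    · simp [Matrix.mulVec, dotProduct, Fin.sum_univ_three, io0, io1, io2]; grind
  · rintro g ⟨k, hk⟩
    refine ⟨-k, fun w => ?_⟩
    have h := hk (lin g⁻¹ w)
    rw [lin_inv_r] at h
    have h2 : io w = (Gm g : Matrix (Fin 3) (Fin 3) R2) *ᵥ ((T (-k) : R2) • io (lin g⁻¹ w)) := by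
      rw [mulVec_smul, h, smul_smul, T_T, neg_add_cancel, T_zero, one_smul]
    rw [h2, mulVec_mulVec, ← Units.val_mul, ← map_mul, inv_mul_cancel, map_one, Units.val_one, one_mulVec]
  · rintro g h ⟨k, hk⟩ ⟨l, hl⟩
    refine ⟨l + k, fun w => ?_⟩
    rw [map_mul, Units.val_mul, ← mulVec_mulVec, hl, mulVec_smul, hk, smul_smul, T_T, lin_mul]

lemma cen_iff (g : F) : Gm g ∈ Subgroup.center (GL (Fin 3) R2) ↔ g ∈ KK := by
  rw [Matrix.GeneralLinearGroup.mem_center_iff_val_mem_range_scalar]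
  obtain ⟨k, hk⟩ := inter g
  constructor
  · rintro ⟨c, hc⟩
    rw [← hc] at hk
    have h : ∀ w, lin g w = (T (-k) * c : R2) • w := by
      intro w
      apply io_inj
      have := hk w
      rw [io_smul, ← smul_smul]
      have e : scalar (Fin 3) c *ᵥ io w = c • io w := by
        rw [scalar_apply, ← smul_one_eq_diagonal, smul_mulVec, one_mulVec]
      rw [← e, this, smul_smul, T_T, neg_add_cancel, T_zero, one_smul]
    obtain ⟨l, b, f, s, hv, hn⟩ := stab_form g _ (h e1)
    refine ⟨l + b, fun w => ?_⟩
    have h1 := hn e1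
    rw [h e1] at h1
    have h2 := congrArg (fun v : V => v.1) h1
    simp only [nn, DD, Prod.smul_fst, smul_eq_mul, mul_one, mul_zero, add_zero, T_T] at h2
    rw [h w, h2]
  · rintro ⟨l, hl⟩
    refine ⟨T (k + l), ?_⟩
    have h : ∀ v, (Gm g : Matrix (Fin 3) (Fin 3) R2) *ᵥ v = (T (k + l) : R2) • v := by
      intro v
      have h1 := hk (ka v)
      rw [hl, io_smul, io_ka, mulVec_smul, smul_smul, T_T, smul_comm] at h1
      funext i
      have := congrFun h1 i
      exact mul_left_cancel₀ (mul_ne opt_ne opt_ne) this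
    refine Matrix.ext_of_mulVec_single fun i => ?_
    rw [h, scalar_apply, ← smul_one_eq_diagonal, smul_mulVec, one_mulVec]

lemma lift_eq : FreeGroup.lift ![pp X, pp Y] = pp.comp Gm := by
  refine FreeGroup.ext_hom _ _ fun i => ?_
  rw [FreeGroup.lift_apply_of, MonoidHom.comp_apply, Gm, FreeGroup.lift_apply_of]
  fin_cases i <;> rfl

lemma final :
    (FreeGroup.lift ![pp X, pp Y]).range = Q42 ∧
      (FreeGroup.lift ![pp X, pp Y]).ker = Subgroup.normalClosure q42RelsD := by
  constructor
  · rw [FreeGroup.range_lift_eq_closure, Q42]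
    congr 1
    simp [Set.pair_comm]
  · change _ = MM
    rw [← KK_eq]
    ext g
    rw [MonoidHom.mem_ker, lift_eq, MonoidHom.comp_apply, ← cen_iff]
    exact QuotientGroup.eq_one_iff _

end QP

/-- **Lemma A.7.** `Q_{4,2}` is presented by generators `x, y` with relations `1_o)`,
`1_c)`, `2_c)`: the homomorphism from the free group on `x, y` sending `x ↦ p(X)`,
`y ↦ p(Y)` has range `Q_{4,2}` and kernel the normal closure of the relators. -/
theorem statement16 :
    (FreeGroup.lift ![pp X, pp Y]).range = Q42 ∧
      (FreeGroup.lift ![pp X, pp Y]).ker = Subgroup.normalClosure q42RelsD := by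
  exact QP.final
end
end

section
/- Let x and y be any two elements of a group, define x_i recursively by x₀ = x, x_{i+1} = [yxy, x_i], and set b_{−i} = [x, (yxy)^{i}] for i ≥ 1. Then for each integer n ≥ 1: x_n lies in the subgroup generated by {x, b_{−1}, b_{−2}, …, b_{−n}}, and b_{−n} lies in the subgroup generated by {x₀, x₁, …, x_n}. -/
theorem conj_mem_aux {G : Type*} [Group G] (t : G) (S : Set G) (H : Subgroup G)
    (h : ∀ g ∈ S, t⁻¹ * g * t ∈ H) (g : G) (hg : g ∈ Subgroup.closure S) :
    t⁻¹ * g * t ∈ H := by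
  have h1 : Subgroup.closure S ≤ H.comap (MulAut.conj t⁻¹).toMonoidHom := by
    rw [Subgroup.closure_le]
    intro g hg
    simpa using h g hg
  simpa using h1 hg

theorem xseq_mem_aux {G : Type*} [Group G] (x y : G) (n : ℕ) :
    xseq x y n ∈ Subgroup.closure
      ({x} ∪ {g | ∃ i : ℕ, 1 ≤ i ∧ i ≤ n ∧ g = br x ((y * x * y) ^ i)}) := by
  induction n with
  | zero => exact Subgroup.subset_closure (Or.inl rfl)
  | succ n ih =>
    have hb : ∀ i ≤ n + 1, br x ((y * x * y) ^ i) ∈ Subgroup.closure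
        ({x} ∪ {g | ∃ i : ℕ, 1 ≤ i ∧ i ≤ n + 1 ∧ g = br x ((y * x * y) ^ i)}) := by
      intro i hi
      rcases Nat.eq_zero_or_pos i with rfl | h
      · simp [br]
      · exact Subgroup.subset_closure (Or.inr ⟨i, h, hi, rfl⟩)
    have hx : x ∈ Subgroup.closure
        ({x} ∪ {g | ∃ i : ℕ, 1 ≤ i ∧ i ≤ n + 1 ∧ g = br x ((y * x * y) ^ i)}) :=
      Subgroup.subset_closure (Or.inl rfl)
    have hmono : xseq x y n ∈ Subgroup.closure
        ({x} ∪ {g | ∃ i : ℕ, 1 ≤ i ∧ i ≤ n + 1 ∧ g = br x ((y * x * y) ^ i)}) := by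
      refine Subgroup.closure_mono ?_ ih
      rintro g (hg | ⟨i, h1, h2, h3⟩)
      · exact Or.inl hg
      · exact Or.inr ⟨i, h1, by omega, h3⟩
    have hc := conj_mem_aux (y * x * y) _ (Subgroup.closure
        ({x} ∪ {g | ∃ i : ℕ, 1 ≤ i ∧ i ≤ n + 1 ∧ g = br x ((y * x * y) ^ i)}))
        (fun g hg => ?_) _ ih
    · have := mul_mem (inv_mem hc) hmono
      convert this using 1
      simp only [xseq, br]
      group
    · generalize y * x * y = t at *
      have h1 := mul_mem hx (hb 1 (by omega))
      rcases hg with hg | ⟨i, h1', h2, rfl⟩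
      · rw [Set.mem_singleton_iff] at hg
        subst hg
        convert h1 using 1
        simp only [br]
        group
      · have h3 := mul_mem (inv_mem h1) (mul_mem hx (hb (i + 1) (by omega)))
        convert h3 using 1
        simp only [br, pow_succ]
        group

theorem br_mem_aux {G : Type*} [Group G] (x y : G) (n : ℕ) :
    x * br x ((y * x * y) ^ n) ∈ Subgroup.closure {g | ∃ i ≤ n, g = xseq x y i} := by
  induction n with
  | zero => exact Subgroup.subset_closure ⟨0, le_rfl, by simp [br, xseq]⟩
  | succ n ih =>
    have hc := conj_mem_aux (y * x * y) _
      (Subgroup.closure {g | ∃ i ≤ n + 1, g = xseq x y i}) (fun g hg => ?_) _ ih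
    · convert hc using 1
      generalize y * x * y = t
      simp only [br, pow_succ]
      group
    · obtain ⟨i, hi, rfl⟩ := hg
      have h1 : xseq x y i ∈ Subgroup.closure {g | ∃ i ≤ n + 1, g = xseq x y i} :=
        Subgroup.subset_closure ⟨i, by omega, rfl⟩
      have h2 : xseq x y (i + 1) ∈ Subgroup.closure {g | ∃ i ≤ n + 1, g = xseq x y i} :=
        Subgroup.subset_closure ⟨i + 1, by omega, rfl⟩
      convert mul_mem h1 (inv_mem h2) using 1
      simp only [xseq, br]
      group

/-- **Claim 2.** For any elements `x, y` of a group and any `n ≥ 1`, the element `x_n`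
lies in the subgroup generated by `{x, b_{-1}, …, b_{-n}}`, and `b_{-n} = [x, (yxy)^n]`
lies in the subgroup generated by `{x₀, x₁, …, x_n}`. -/
theorem statement17 {G : Type*} [Group G] (x y : G) (n : ℕ) (hn : 1 ≤ n) :
    xseq x y n ∈
        Subgroup.closure
          ({x} ∪ {g | ∃ i : ℕ, 1 ≤ i ∧ i ≤ n ∧ g = br x ((y * x * y) ^ i)}) ∧
      br x ((y * x * y) ^ n) ∈
        Subgroup.closure {g | ∃ i ≤ n, g = xseq x y i} := by
  refine ⟨xseq_mem_aux x y n, ?_⟩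
  have h0 : x ∈ Subgroup.closure {g | ∃ i ≤ n, g = xseq x y i} :=
    Subgroup.subset_closure ⟨0, by omega, rfl⟩
  exact (Subgroup.mul_mem_cancel_left _ h0).1 (br_mem_aux x y n)
end

section
/- Let G be a group and x, y ∈ G, with x_i defined recursively by x₀ = x and x_{i+1} = [yxy, x_i]. Suppose that x_i⁴ = 1 and [x_i², yxy] = 1 for every integer i ≥ 0. Then for every pair of nonnegative integers (i, j): [x_i², x_j] = 1, and the commutator [x_i, x_j] lies in the subgroup generated by {x₀², x₁², …, x_k²} where k = max(i, j). -/
lemma aux_alg {G : Type*} [Group G] {a b c d z s s' t : G}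
    (hs : a * c = c * a * s) (hs' : b * c = c * b * s') (ht : b * d = d * b * t)
    (ha : z⁻¹ * a * z = a * b⁻¹) (hc : z⁻¹ * c * z = c * d⁻¹) (hz : Commute s z)
    (sb : Commute s b) (sd : Commute s d)
    (s'b : Commute s' b) (s'd : Commute s' d)
    (tb : Commute t b) (td : Commute t d) (ss' : Commute s s') : br a d = s'⁻¹ * t := by
  have e1 : (a * b⁻¹) * (c * d⁻¹) = (c * d⁻¹) * (a * b⁻¹) * s := by
    rw [← ha, ← hc]
    have : z⁻¹ * s * z = s := by rw [mul_assoc, hz.eq]; group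
    calc z⁻¹ * a * z * (z⁻¹ * c * z) = z⁻¹ * (a * c) * z := by group
      _ = z⁻¹ * c * z * (z⁻¹ * a * z) * (z⁻¹ * s * z) := by rw [hs]; group
      _ = _ := by rw [this]
  have e2 : b⁻¹ * c = c * b⁻¹ * s'⁻¹ := by
    have h : c * b = b * c * s'⁻¹ := by rw [hs']; group
    calc b⁻¹ * c = b⁻¹ * (c * b) * b⁻¹ := by group
      _ = c * (s'⁻¹ * b⁻¹) := by rw [h]; group
      _ = _ := by rw [(s'b.inv_inv).eq]; group
  have e3 : b⁻¹ * d⁻¹ = t * d⁻¹ * b⁻¹ := by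
    have h : t = b⁻¹ * d⁻¹ * (b * d) := by rw [ht]; group
    rw [h]; group
  have e4 : (a * b⁻¹) * (c * d⁻¹) = c * a * (d⁻¹ * t * s'⁻¹) * b⁻¹ * s := by
    calc (a * b⁻¹) * (c * d⁻¹) = a * (b⁻¹ * c) * d⁻¹ := by group
      _ = (a * c) * b⁻¹ * (s'⁻¹ * d⁻¹) := by rw [e2]; group
      _ = c * a * s * (b⁻¹ * d⁻¹) * s'⁻¹ := by rw [(s'd.inv_inv).eq, hs]; group
      _ = c * a * s * (t * d⁻¹) * (b⁻¹ * s'⁻¹) := by rw [e3]; group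
      _ = c * a * s * (d⁻¹ * t) * (s'⁻¹ * b⁻¹) := by
          rw [(s'b.inv_inv).eq, (td.inv_right).eq]
      _ = c * a * (s * (d⁻¹ * t * s'⁻¹ * b⁻¹)) := by group
      _ = c * a * ((d⁻¹ * t * s'⁻¹ * b⁻¹) * s) := by
          congr 1
          have st : Commute s t := by
            have : t = b⁻¹ * d⁻¹ * (b * d) := by rw [ht]; group
            rw [this]
            exact (sb.inv_right.mul_right sd.inv_right).mul_right (sb.mul_right sd)
          exact ((sd.inv_right.mul_right st).mul_right ss'.inv_right).mul_right sb.inv_right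
      _ = _ := by group
  rw [e4] at e1
  have e5 : a * (d⁻¹ * t * s'⁻¹) = d⁻¹ * a := by
    have := mul_right_cancel e1
    have h := congrArg (fun g => c⁻¹ * g * b) this
    simpa [mul_assoc] using h
  have : a⁻¹ * d⁻¹ * a = d⁻¹ * t * s'⁻¹ := by rw [mul_assoc, ← e5]; group
  rw [br, this, mul_assoc, (s'd.inv_left).eq, mul_assoc d⁻¹, ← mul_assoc t, td.eq]
  have st : Commute s' t := by
    have : t = b⁻¹ * d⁻¹ * (b * d) := by rw [ht]; group
    rw [this]
    exact (s'b.inv_right.mul_right s'd.inv_right).mul_right (s'b.mul_right s'd)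
  rw [st.inv_left.eq]; group

lemma br_one_iff {G : Type*} [Group G] {a b : G} : br a b = 1 ↔ Commute a b := by
  unfold br
  constructor
  · intro h
    have h' := congrArg (fun g => b * a * g) h
    show a * b = b * a
    simpa [mul_assoc] using h'
  · intro h
    rw [mul_assoc, h.eq]; group

lemma br_eq {G : Type*} [Group G] (a b : G) : a * b = b * a * br a b := by
  unfold br; group

def SS {G : Type*} [Group G] (X : ℕ → G) (n : ℕ) : Subgroup G :=
  Subgroup.closure {g | ∃ k ≤ n, g = X k ^ 2}

lemma SS_comm {G : Type*} [Group G] {X : ℕ → G} {n : ℕ} {g u : G}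
    (h : ∀ k ≤ n, Commute (X k ^ 2) g) (hu : u ∈ SS X n) : Commute u g := by
  unfold SS at hu
  induction hu using Subgroup.closure_induction with
  | mem x hx => obtain ⟨k, hk, rfl⟩ := hx; exact h k hk
  | one => exact Commute.one_left g
  | mul x y _ _ hx hy => exact hx.mul_left hy
  | inv x _ hx => exact hx.inv_left

lemma SS_mono {G : Type*} [Group G] {X : ℕ → G} {m n : ℕ} (h : m ≤ n) : SS X m ≤ SS X n :=
  Subgroup.closure_mono (fun _ ⟨k, hk, e⟩ => ⟨k, hk.trans h, e⟩)

section
variable {G : Type*} [Group G] {X : ℕ → G} {z : G}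

lemma le_comm (hX : ∀ i, X (i+1) = br z (X i)) (h2 : ∀ i, Commute (X i ^ 2) z) (i n : ℕ) :
    Commute (X i ^ 2) (X (i + n)) := by
  induction n with
  | zero => exact (Commute.refl _).pow_left 2
  | succ n ih =>
    rw [← add_assoc, hX, br]
    exact (((h2 i).inv_right.mul_right ih.inv_right).mul_right (h2 i)).mul_right ih

lemma le_comm' (hX : ∀ i, X (i+1) = br z (X i)) (h2 : ∀ i, Commute (X i ^ 2) z) {i j : ℕ}
    (h : i ≤ j) : Commute (X i ^ 2) (X j) := by
  obtain ⟨n, rfl⟩ := Nat.exists_eq_add_of_le h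
  exact le_comm hX h2 i n

lemma sq_comm (hX : ∀ i, X (i+1) = br z (X i)) (h2 : ∀ i, Commute (X i ^ 2) z) (i j : ℕ) :
    Commute (X i ^ 2) (X j ^ 2) := by
  rcases le_total i j with h | h
  · exact (le_comm' hX h2 h).pow_right 2
  · exact ((le_comm' hX h2 h).pow_right 2).symm

lemma SS_sq (hX : ∀ i, X (i+1) = br z (X i)) (h2 : ∀ i, Commute (X i ^ 2) z)
    (h1 : ∀ i, X i ^ 4 = 1) {n : ℕ} {u : G} (hu : u ∈ SS X n) : u ^ 2 = 1 := by
  have key : ∀ v ∈ SS X n, ∀ w ∈ SS X n, Commute v w := fun v hv w hw =>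
    SS_comm (fun k _ => (SS_comm (fun l _ => sq_comm hX h2 l k) hw).symm) hv
  unfold SS at hu
  induction hu using Subgroup.closure_induction with
  | mem x hx => obtain ⟨k, hk, rfl⟩ := hx; rw [← pow_mul]; exact h1 k
  | one => simp
  | mul x y hx' hy' hx hy => rw [(key x hx' y hy').mul_pow, hx, hy, one_mul]
  | inv x _ hx => rw [inv_pow, hx, inv_one]

lemma conj_eq (hX : ∀ i, X (i+1) = br z (X i)) (i : ℕ) :
    z⁻¹ * X i * z = X i * (X (i+1))⁻¹ := by
  rw [hX, br]; group

lemma sq_mem {n : ℕ} : X n ^ 2 ∈ SS X n := Subgroup.subset_closure ⟨n, le_rfl, rfl⟩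

lemma main_aux (hX : ∀ i, X (i+1) = br z (X i)) (h2 : ∀ i, Commute (X i ^ 2) z)
    (h1 : ∀ i, X i ^ 4 = 1) (n : ℕ) :
    ∀ i, Commute (X (i+n) ^ 2) (X i) ∧ br (X i) (X (i+n)) ∈ SS X (i+n) := by
  induction n using Nat.strong_induction_on with
  | _ n ih =>
  intro i
  have fin : ∀ u ∈ SS X (i+n), br (X i) (X (i+n)) = u →
      Commute (X (i+n) ^ 2) (X i) ∧ br (X i) (X (i+n)) ∈ SS X (i+n) := by
    intro u hu e
    refine ⟨?_, e ▸ hu⟩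
    have ud : Commute u (X (i+n)) := SS_comm (fun k hk => le_comm' hX h2 hk) hu
    have u2 := SS_sq hX h2 h1 hu
    have e' : (X i)⁻¹ * (X (i+n))⁻¹ * X i = u * (X (i+n))⁻¹ := by
      rw [← e, br]; group
    have e2 : (X i)⁻¹ * ((X (i+n))⁻¹)^2 * X i = ((X (i+n))⁻¹)^2 := by
      calc _ = ((X i)⁻¹ * (X (i+n))⁻¹ * X i) ^ 2 := by simp only [pow_two]; group
        _ = _ := by rw [e', ud.inv_right.mul_pow, u2, one_mul]
    have e3 : Commute (((X (i+n))⁻¹)^2) (X i) := by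
      show _ * _ = _ * _
      conv_rhs => rw [← e2]
      group
    rw [inv_pow] at e3
    simpa using e3.inv_left
  match n, ih, fin with
  | 0, _, fin => exact fin 1 (one_mem _) (by simp [br])
  | 1, _, fin =>
    refine fin (X (i+1) ^ 2) sq_mem ?_
    have e := conj_eq hX i
    have q : z⁻¹ * X i ^ 2 * z = X i ^ 2 := by rw [mul_assoc, (h2 i).eq]; group
    have q2 : (X i * (X (i+1))⁻¹) ^ 2 = X i ^ 2 := by
      rw [← e, ← q]; simp only [pow_two]; group
    have q3 : (X (i+1))⁻¹ * X i * (X (i+1))⁻¹ = X i := by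
      have := congrArg (fun g => (X i)⁻¹ * g) q2
      simpa [pow_two, mul_assoc] using this
    have q4 : (X (i+1))⁻¹ * X i = X i * X (i+1) := by
      conv_rhs => rw [← q3]
      group
    rw [br, mul_assoc (X i)⁻¹, q4, pow_two]; group
  | m+2, ih, fin =>
    have s_mem := (ih (m+1) (by omega) i).2
    have s'_mem := (ih m (by omega) (i+1)).2
    have t_mem := (ih (m+1) (by omega) (i+1)).2
    have r1 : i + 1 + m = i + (m+1) := by omega
    have r2 : i + 1 + (m + 1) = i + (m+2) := by omega
    rw [r1] at s'_mem
    rw [r2] at t_mem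
    have cb : ∀ k ≤ i + (m+2), Commute (X k ^ 2) (X (i+1)) := by
      intro k hk
      rcases le_total k (i+1) with h | h
      · exact le_comm' hX h2 h
      · obtain ⟨l, rfl⟩ := Nat.exists_eq_add_of_le h
        exact (ih l (by omega) (i+1)).1
    have cd : ∀ k ≤ i + (m+2), Commute (X k ^ 2) (X (i+(m+2))) :=
      fun k hk => le_comm' hX h2 hk
    have mo : SS X (i+(m+1)) ≤ SS X (i+(m+2)) := SS_mono (by omega)
    refine fin _ (mul_mem (inv_mem (mo s'_mem)) t_mem) ?_
    exact aux_alg (br_eq _ _) (br_eq _ _) (br_eq _ _) (conj_eq hX i) (conj_eq hX (i+(m+1)))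
      (SS_comm (fun k _ => h2 k) s_mem)
      (SS_comm cb (mo s_mem)) (SS_comm cd (mo s_mem))
      (SS_comm cb (mo s'_mem)) (SS_comm cd (mo s'_mem))
      (SS_comm cb t_mem) (SS_comm cd t_mem)
      (SS_comm (fun k _ => (SS_comm (fun l _ => sq_comm hX h2 l k) s'_mem).symm) s_mem)
end

/-- **Claim 3.** If `x_i⁴ = 1` and `[x_i², yxy] = 1` for all `i ≥ 0`, then for all
`i, j ≥ 0` one has `[x_i², x_j] = 1` and `[x_i, x_j]` lies in the subgroup generated by
`{x₀², x₁², …, x_k²}` with `k = max(i,j)`. -/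
theorem statement18 {G : Type*} [Group G] (x y : G)
    (h1 : ∀ i : ℕ, xseq x y i ^ 4 = 1)
    (h2 : ∀ i : ℕ, br (xseq x y i ^ 2) (y * x * y) = 1) (i j : ℕ) :
    br (xseq x y i ^ 2) (xseq x y j) = 1 ∧
      br (xseq x y i) (xseq x y j) ∈
        Subgroup.closure {g | ∃ k ≤ max i j, g = xseq x y k ^ 2} := by
  have hX : ∀ i, xseq x y (i+1) = br (y * x * y) (xseq x y i) := fun _ => rfl
  have h2' : ∀ i, Commute (xseq x y i ^ 2) (y * x * y) := fun i => br_one_iff.1 (h2 i)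
  have key := main_aux hX h2' h1
  rcases le_total i j with h | h
  · refine ⟨br_one_iff.2 (le_comm' hX h2' h), ?_⟩
    rw [max_eq_right h]
    obtain ⟨n, rfl⟩ := Nat.exists_eq_add_of_le h
    exact (key n i).2
  · obtain ⟨n, rfl⟩ := Nat.exists_eq_add_of_le h
    refine ⟨br_one_iff.2 (key n j).1, ?_⟩
    rw [max_eq_left h]
    have e : br (xseq x y (j+n)) (xseq x y j) = (br (xseq x y j) (xseq x y (j+n)))⁻¹ := by
      unfold br; group
    rw [e]
    exact inv_mem (key n j).2
end

section
/- In the HNN extension G, the element ε([yxy,x]⁴) lies in the normal closure of the single element α = [yxy,x]·t·x⁻¹·t⁻¹; explicitly, writing δ = t·x·t⁻¹, one has ε([yxy,x]⁴) = α·(δαδ⁻¹)·(δ²αδ⁻²)·(δ³αδ⁻³) in G. -/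
noncomputable section

/-- Relators of `Q₄ = ⟨x, y | x⁴ = y³ = 1, [x², yxy] = 1⟩`. -/
def q4Rels : Set (FreeGroup (Fin 2)) :=
  {(FreeGroup.of 0) ^ 4, (FreeGroup.of 1) ^ 3,
    br ((FreeGroup.of 0) ^ 2) (FreeGroup.of 1 * FreeGroup.of 0 * FreeGroup.of 1)}

/-- `Q₄ = B₄/Z(B₄)`, presented as `⟨x, y | x⁴ = y³ = 1, [x², yxy] = 1⟩`. -/
abbrev Q4 : Type := PresentedGroup q4Rels

/-- The generator `x` of `Q₄` (the class of `σ₁σ₂σ₃`). -/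
def qx : Q4 := PresentedGroup.of 0

/-- The generator `y` of `Q₄` (the class of `σ₁σ₂σ₃σ₁`). -/
def qy : Q4 := PresentedGroup.of 1

/-- `G`, the HNN extension of `Q₄` along the identity isomorphism of the subgroup `⟨yxy⟩`. -/
abbrev GrpG : Type :=
  HNNExtension Q4 (Subgroup.zpowers (qy * qx * qy)) (Subgroup.zpowers (qy * qx * qy))
    (MulEquiv.refl _)

/-- The canonical injection `ε : Q₄ ↪ G`. -/
def εQ : Q4 →* GrpG := HNNExtension.of

/-- The stable letter `t` of the HNN extension `G`. -/
def tG : GrpG := HNNExtension.t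

/-- The element `α = [yxy,x]·t·x⁻¹·t⁻¹` of `G`. -/
def αG : GrpG := br (εQ (qy * qx * qy)) (εQ qx) * tG * (εQ qx)⁻¹ * tG⁻¹

/-- The element `δ = t·x·t⁻¹` of `G`. -/
def δG : GrpG := tG * εQ qx * tG⁻¹

/-- In the HNN extension `G`, the element `ε([yxy,x]⁴)` lies in the normal closure of the
single element `α = [yxy,x]·t·x⁻¹·t⁻¹`; explicitly, with `δ = t·x·t⁻¹`,
`ε([yxy,x]⁴) = α·(δαδ⁻¹)·(δ²αδ⁻²)·(δ³αδ⁻³)`. -/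
theorem statement19 :
    εQ ((br (qy * qx * qy) qx) ^ 4) ∈ Subgroup.normalClosure {αG} ∧
      εQ ((br (qy * qx * qy) qx) ^ 4) =
        αG * (δG * αG * δG⁻¹) * (δG ^ 2 * αG * (δG ^ 2)⁻¹) * (δG ^ 3 * αG * (δG ^ 3)⁻¹) := by
  have hx : qx ^ 4 = 1 := by
    have h : PresentedGroup.mk q4Rels ((FreeGroup.of 0) ^ 4) = 1 :=
      PresentedGroup.one_of_mem (by simp [q4Rels])
    rw [map_pow] at h
    exact h
  have hd : δG ^ 4 = 1 := by
    unfold δG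
    rw [conj_pow, ← map_pow, hx]
    simp
  have hα : αG = εQ (br (qy * qx * qy) qx) * δG⁻¹ := by
    simp only [αG, δG, br, map_mul, map_inv]
    group
  have key : εQ ((br (qy * qx * qy) qx) ^ 4) =
        αG * (δG * αG * δG⁻¹) * (δG ^ 2 * αG * (δG ^ 2)⁻¹) * (δG ^ 3 * αG * (δG ^ 3)⁻¹) := by
    rw [hα, map_pow]
    generalize εQ (br (qy * qx * qy) qx) = c
    generalize δG = d at hd
    have : c ^ 4 = c ^ 4 * (d ^ 4)⁻¹ := by rw [hd]; simp
    rw [this]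
    simp only [pow_succ, pow_zero, one_mul, mul_inv_rev, mul_assoc, inv_mul_cancel_left]
  refine ⟨?_, key⟩
  rw [key]
  have h0 : αG ∈ Subgroup.normalClosure {αG} := Subgroup.subset_normalClosure rfl
  have hc : ∀ g : GrpG, g * αG * g⁻¹ ∈ Subgroup.normalClosure {αG} := fun g =>
    Subgroup.normalClosure_normal.conj_mem _ h0 g
  exact mul_mem (mul_mem (mul_mem h0 (hc _)) (hc _)) (hc _)
end
end
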